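/- arXiv:0905.0478 — 5 statements merged into one kernel-verified Lean document; each statement's English description precedes it below -/
import Mathlib

section
/- Let E be a graph satisfying Condition (L) and let R be a commutative ring with unit. If x ∈ L_R(E) is a nonzero polynomial in only real edges (i.e., x = Σᵢ rᵢ αᵢ with rᵢ ∈ R \ {0} and αᵢ ∈ E*), then there exist paths α, β ∈ E* such that α* x β = r·v for some vertex v ∈ E⁰ and some r ∈ R \ {0}. -/
set_option maxHeartbeats 1000000
set_option synthInstance.maxHeartbeats 400000

noncomputable section

/-- A directed graph `E = (E⁰, E¹, r, s)` with countable vertex and edge sets,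
together with range and source maps. -/
structure LPAGraph : Type 1 where
  V : Type
  E : Type
  countV : Countable V
  countE : Countable E
  src : E → V
  rng : E → V

namespace LPAGraph

/-- Generators of the Leavitt path algebra: vertices, real edges, and ghost edges. -/
inductive LGen (G : LPAGraph) : Type
  | vert : G.V → LGen G
  | edge : G.E → LGen G
  | ghost : G.E → LGen G

/-- `IsPathFrom G u es w` : the list of edges `es` is a path from `u` to `w`
(paths of length zero are vertices). -/
inductive IsPathFrom (G : LPAGraph) : G.V → List G.E → G.V → Prop
  | nil (v : G.V) : IsPathFrom G v [] v
  | cons {u w : G.V} (e : G.E) {es : List G.E} (h : G.src e = u)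
      (ht : IsPathFrom G (G.rng e) es w) : IsPathFrom G u (e :: es) w

/-- A vertex is regular if it emits at least one and only finitely many edges. -/
def Regular (G : LPAGraph) (v : G.V) : Prop :=
  {e : G.E | G.src e = v}.Finite ∧ {e : G.E | G.src e = v}.Nonempty

/-- A graph is row-finite if every vertex emits only finitely many edges. -/
def RowFinite (G : LPAGraph) : Prop := ∀ v : G.V, {e : G.E | G.src e = v}.Finite

/-- A subset `H` of vertices is hereditary if `s(e) ∈ H` implies `r(e) ∈ H`. -/
def Hereditary (G : LPAGraph) (H : Set G.V) : Prop :=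
  ∀ e : G.E, G.src e ∈ H → G.rng e ∈ H

/-- A subset `H` of vertices is saturated if every regular vertex, all of whose emitted
edges have range in `H`, belongs to `H`. -/
def Saturated (G : LPAGraph) (H : Set G.V) : Prop :=
  ∀ v : G.V, G.Regular v → (∀ e : G.E, G.src e = v → G.rng e ∈ H) → v ∈ H

/-- The saturation of a set of vertices: the smallest saturated hereditary subset
containing it. -/
def saturation (G : LPAGraph) (X : Set G.V) : Set G.V :=
  ⋂₀ {H : Set G.V | G.Hereditary H ∧ G.Saturated H ∧ X ⊆ H}

/-- `HasExit G es` : the path `es` has an exit, i.e. there is an edge `f` with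
`s(f) = s(eᵢ)` and `f ≠ eᵢ` for some `i`. -/
def HasExit (G : LPAGraph) (es : List G.E) : Prop :=
  ∃ (f : G.E) (i : Fin es.length), G.src f = G.src (es.get i) ∧ f ≠ es.get i

/-- Condition (L): every cycle has an exit. -/
def CondL (G : LPAGraph) : Prop :=
  ∀ (v : G.V) (es : List G.E), es ≠ [] → IsPathFrom G v es v → G.HasExit es

/-- A closed path based at `v`. -/
def IsClosedPathAt (G : LPAGraph) (v : G.V) (es : List G.E) : Prop :=
  es ≠ [] ∧ IsPathFrom G v es v

/-- A simple closed path based at `v` : a closed path `e₁ … eₙ` based at `v` with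
`s(eᵢ) ≠ v` for `i = 2, …, n`. -/
def IsSimpleClosedPathAt (G : LPAGraph) (v : G.V) (es : List G.E) : Prop :=
  G.IsClosedPathAt v es ∧ ∀ i : Fin es.length, i.1 ≠ 0 → G.src (es.get i) ≠ v

/-- Condition (K): every vertex is the base of no closed path or of at least two
distinct simple closed paths. -/
def CondK (G : LPAGraph) : Prop :=
  ∀ v : G.V, (¬ ∃ es : List G.E, G.IsClosedPathAt v es) ∨
    (∃ es₁ es₂ : List G.E, G.IsSimpleClosedPathAt v es₁ ∧ G.IsSimpleClosedPathAt v es₂ ∧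
      es₁ ≠ es₂)

variable (R : Type) [CommRing R] (G : LPAGraph)

open FreeAlgebra in
/-- The defining relations of the Leavitt path algebra (the relations of a
Leavitt `E`-family). -/
inductive LeavittRel : FreeAlgebra R (LGen G) → FreeAlgebra R (LGen G) → Prop
  | vert_mul_self (v : G.V) :
      LeavittRel (ι R (LGen.vert v) * ι R (LGen.vert v)) (ι R (LGen.vert v))
  | vert_mul_vert (v w : G.V) (hvw : v ≠ w) :
      LeavittRel (ι R (LGen.vert v) * ι R (LGen.vert w)) 0
  | src_mul_edge (e : G.E) :
      LeavittRel (ι R (LGen.vert (G.src e)) * ι R (LGen.edge e)) (ι R (LGen.edge e))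
  | edge_mul_rng (e : G.E) :
      LeavittRel (ι R (LGen.edge e) * ι R (LGen.vert (G.rng e))) (ι R (LGen.edge e))
  | rng_mul_ghost (e : G.E) :
      LeavittRel (ι R (LGen.vert (G.rng e)) * ι R (LGen.ghost e)) (ι R (LGen.ghost e))
  | ghost_mul_src (e : G.E) :
      LeavittRel (ι R (LGen.ghost e) * ι R (LGen.vert (G.src e))) (ι R (LGen.ghost e))
  | ghost_mul_self (e : G.E) :
      LeavittRel (ι R (LGen.ghost e) * ι R (LGen.edge e)) (ι R (LGen.vert (G.rng e)))
  | ghost_mul_edge (e f : G.E) (hef : e ≠ f) :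
      LeavittRel (ι R (LGen.ghost e) * ι R (LGen.edge f)) 0
  | ck (v : G.V) (s : Finset G.E) (hs : ∀ e : G.E, e ∈ s ↔ G.src e = v) (hne : s.Nonempty) :
      LeavittRel (ι R (LGen.vert v)) (∑ e ∈ s, ι R (LGen.edge e) * ι R (LGen.ghost e))

/-- The ambient unital algebra: the universal unital `R`-algebra on the Leavitt relations. -/
abbrev Ambient : Type := RingQuot (LeavittRel R G)

/-- The images of the generators in the ambient algebra. -/
def ugen (x : LGen G) : Ambient R G :=
  RingQuot.mkAlgHom R (LeavittRel R G) (FreeAlgebra.ι R x)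

/-- The Leavitt path algebra `L_R(E)`, realized as the non-unital subalgebra of the ambient
algebra generated by the Leavitt `E`-family (equivalently, the span of words in the
generators). -/
def LeavittSubalgebra : NonUnitalSubalgebra R (Ambient R G) :=
  NonUnitalAlgebra.adjoin R (Set.range (ugen R G))

/-- The Leavitt path algebra `L_R(E)` as a type; it is a non-unital `R`-algebra. -/
abbrev LeavittPathAlgebra : Type := ↥(LeavittSubalgebra R G)

theorem ugen_mem (x : LGen G) : ugen R G x ∈ LeavittSubalgebra R G :=
  NonUnitalAlgebra.subset_adjoin R (Set.mem_range_self x)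

/-- The vertex idempotent `v ∈ L_R(E)`. -/
def vertexElem (v : G.V) : LeavittPathAlgebra R G :=
  ⟨ugen R G (LGen.vert v), ugen_mem R G _⟩

/-- The real edge `e ∈ L_R(E)`. -/
def edgeElem (e : G.E) : LeavittPathAlgebra R G :=
  ⟨ugen R G (LGen.edge e), ugen_mem R G _⟩

/-- The ghost edge `e* ∈ L_R(E)`. -/
def ghostElem (e : G.E) : LeavittPathAlgebra R G :=
  ⟨ugen R G (LGen.ghost e), ugen_mem R G _⟩

/-- The element `α = e₁ ⋯ eₙ` of the ambient algebra corresponding to a path; a path of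
length zero starting at `u` is the vertex `u`. -/
def uPath (u : G.V) (es : List G.E) : Ambient R G :=
  ugen R G (LGen.vert u) * (es.map fun e => ugen R G (LGen.edge e)).prod

/-- The element `α* = eₙ* ⋯ e₁*` of the ambient algebra corresponding to a ghost path. -/
def uGhostPath (u : G.V) (es : List G.E) : Ambient R G :=
  ((es.map fun e => ugen R G (LGen.ghost e)).reverse).prod * ugen R G (LGen.vert u)

private theorem list_prod_mem_aux (f : G.E → Ambient R G)
    (hf : ∀ e, f e ∈ LeavittSubalgebra R G) :
    ∀ es : List G.E, es ≠ [] → (es.map f).prod ∈ LeavittSubalgebra R G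
  | [], h => absurd rfl h
  | [e], _ => by simpa using hf e
  | e :: e' :: t, _ => by
      rw [List.map_cons, List.prod_cons]
      exact mul_mem (hf e) (list_prod_mem_aux f hf (e' :: t) (by simp))

theorem uPath_mem (u : G.V) (es : List G.E) : uPath R G u es ∈ LeavittSubalgebra R G := by
  cases es with
  | nil => simpa [uPath] using ugen_mem R G (LGen.vert u)
  | cons e t =>
      exact mul_mem (ugen_mem R G (LGen.vert u))
        (list_prod_mem_aux R G _ (fun e => ugen_mem R G (LGen.edge e)) (e :: t) (by simp))

theorem uGhostPath_mem (u : G.V) (es : List G.E) :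
    uGhostPath R G u es ∈ LeavittSubalgebra R G := by
  cases es with
  | nil => simpa [uGhostPath] using ugen_mem R G (LGen.vert u)
  | cons e t =>
      rw [uGhostPath, ← List.map_reverse]
      exact mul_mem
        (list_prod_mem_aux R G _ (fun e => ugen_mem R G (LGen.ghost e)) ((e :: t).reverse)
          (by simp))
        (ugen_mem R G (LGen.vert u))

/-- The element of `L_R(E)` corresponding to the path `α` with source `u` and edge list
`es` (for `es = []` this is the vertex `u`). -/
def pathElem (u : G.V) (es : List G.E) : LeavittPathAlgebra R G :=
  ⟨uPath R G u es, uPath_mem R G u es⟩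

/-- The element of `L_R(E)` corresponding to the ghost path `α*` where `α` has source `u`
and edge list `es` (for `es = []` this is the vertex `u`). -/
def ghostPathElem (u : G.V) (es : List G.E) : LeavittPathAlgebra R G :=
  ⟨uGhostPath R G u es, uGhostPath_mem R G u es⟩

/-- The set of monomials `α β*` where `α, β` are paths with `r(α) = r(β)`. -/
def monomialSet : Set (LeavittPathAlgebra R G) :=
  {x | ∃ (u : G.V) (es : List G.E) (u' : G.V) (es' : List G.E) (w : G.V),
    IsPathFrom G u es w ∧ IsPathFrom G u' es' w ∧
    x = pathElem R G u es * ghostPathElem R G u' es'}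

/-- The degree-`k` homogeneous component `L_R(E)ₖ` of the canonical `ℤ`-grading:
the `R`-span of the monomials `α β*` with `|α| - |β| = k`. -/
def component (k : ℤ) : Submodule R (LeavittPathAlgebra R G) :=
  Submodule.span R
    {x | ∃ (u : G.V) (es : List G.E) (u' : G.V) (es' : List G.E) (w : G.V),
      IsPathFrom G u es w ∧ IsPathFrom G u' es' w ∧
      (es.length : ℤ) - (es'.length : ℤ) = k ∧
      x = pathElem R G u es * ghostPathElem R G u' es'}

/-- An ideal `I` of `L_R(E)` is basic if `r • v ∈ I` with `r ∈ R \ {0}` and `v` a vertex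
implies `v ∈ I`. -/
def IsBasicIdeal (I : TwoSidedIdeal (LeavittPathAlgebra R G)) : Prop :=
  ∀ (r : R) (v : G.V), r ≠ 0 → r • vertexElem R G v ∈ I → vertexElem R G v ∈ I

/-- An ideal `I` of the `ℤ`-graded ring `L_R(E)` is graded if `I = ⊕ₖ (I ∩ L_R(E)ₖ)`,
i.e. every element of `I` is a finite sum of homogeneous elements of `I`. -/
def IsGradedIdeal (I : TwoSidedIdeal (LeavittPathAlgebra R G)) : Prop :=
  ∀ x ∈ I, ∃ (n : ℕ) (c : Fin n → LeavittPathAlgebra R G),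
    (∀ i, c i ∈ I ∧ ∃ k : ℤ, c i ∈ component R G k) ∧ x = ∑ i, c i

/-- The two-sided ideal of `L_R(E)` generated by the vertices in a set `H` of vertices. -/
def idealOfSet (H : Set G.V) : TwoSidedIdeal (LeavittPathAlgebra R G) :=
  TwoSidedIdeal.span {x | ∃ v ∈ H, x = vertexElem R G v}

/-- `x ∈ L_R(E)` is a polynomial in only real edges if it is an `R`-linear combination of
(real) paths. -/
def IsRealPoly (x : LeavittPathAlgebra R G) : Prop :=
  x ∈ Submodule.span R
    {y | ∃ (u : G.V) (es : List G.E) (w : G.V), IsPathFrom G u es w ∧ y = pathElem R G u es}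

end LPAGraph

namespace LPAGraph

section Aux

variable {R : Type} [CommRing R] {G : LPAGraph}

theorem aux_rel {a b : FreeAlgebra R (LGen G)} (h : LeavittRel R G a b) :
    RingQuot.mkAlgHom R (LeavittRel R G) a = RingQuot.mkAlgHom R (LeavittRel R G) b :=
  RingQuot.mkAlgHom_rel R h

theorem aux_vv (v : G.V) :
    ugen R G (LGen.vert v) * ugen R G (LGen.vert v) = ugen R G (LGen.vert v) := by
  simpa [ugen] using aux_rel (LeavittRel.vert_mul_self (R := R) v)

theorem aux_vw {v w : G.V} (h : v ≠ w) :
    ugen R G (LGen.vert v) * ugen R G (LGen.vert w) = 0 := by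
  simpa [ugen] using aux_rel (LeavittRel.vert_mul_vert (R := R) v w h)

theorem aux_se (e : G.E) :
    ugen R G (LGen.vert (G.src e)) * ugen R G (LGen.edge e) = ugen R G (LGen.edge e) := by
  simpa [ugen] using aux_rel (LeavittRel.src_mul_edge (R := R) e)

theorem aux_er (e : G.E) :
    ugen R G (LGen.edge e) * ugen R G (LGen.vert (G.rng e)) = ugen R G (LGen.edge e) := by
  simpa [ugen] using aux_rel (LeavittRel.edge_mul_rng (R := R) e)

theorem aux_rg (e : G.E) :
    ugen R G (LGen.vert (G.rng e)) * ugen R G (LGen.ghost e) = ugen R G (LGen.ghost e) := by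
  simpa [ugen] using aux_rel (LeavittRel.rng_mul_ghost (R := R) e)

theorem aux_gs (e : G.E) :
    ugen R G (LGen.ghost e) * ugen R G (LGen.vert (G.src e)) = ugen R G (LGen.ghost e) := by
  simpa [ugen] using aux_rel (LeavittRel.ghost_mul_src (R := R) e)

theorem aux_ge (e : G.E) :
    ugen R G (LGen.ghost e) * ugen R G (LGen.edge e) = ugen R G (LGen.vert (G.rng e)) := by
  simpa [ugen] using aux_rel (LeavittRel.ghost_mul_self (R := R) e)

theorem aux_gf {e f : G.E} (h : e ≠ f) :
    ugen R G (LGen.ghost e) * ugen R G (LGen.edge f) = 0 := by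
  simpa [ugen] using aux_rel (LeavittRel.ghost_mul_edge (R := R) e f h)

theorem aux_path_nil (u : G.V) : uPath R G u [] = ugen R G (LGen.vert u) := by
  simp [uPath]

theorem aux_path_cons (e : G.E) (es : List G.E) :
    uPath R G (G.src e) (e :: es) = ugen R G (LGen.edge e) * uPath R G (G.rng e) es := by
  simp only [uPath, List.map_cons, List.prod_cons]
  rw [← mul_assoc, ← mul_assoc, aux_se, aux_er]

theorem aux_gpath_nil (u : G.V) : uGhostPath R G u [] = ugen R G (LGen.vert u) := by
  simp [uGhostPath]

theorem aux_gpath_cons (e : G.E) (es : List G.E) :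
    uGhostPath R G (G.src e) (e :: es) =
      uGhostPath R G (G.rng e) es * ugen R G (LGen.ghost e) := by
  simp only [uGhostPath, List.map_cons, List.reverse_cons, List.prod_append, List.prod_singleton]
  rw [mul_assoc, mul_assoc, aux_gs, aux_rg]

theorem aux_v_path (u : G.V) (es : List G.E) :
    ugen R G (LGen.vert u) * uPath R G u es = uPath R G u es := by
  rw [uPath, ← mul_assoc, aux_vv]

theorem aux_v_path_ne {u u' : G.V} (h : u ≠ u') (es : List G.E) :
    ugen R G (LGen.vert u) * uPath R G u' es = 0 := by
  rw [uPath, ← mul_assoc, aux_vw h, zero_mul]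

theorem aux_gpath_v (u : G.V) (es : List G.E) :
    uGhostPath R G u es * ugen R G (LGen.vert u) = uGhostPath R G u es := by
  rw [uGhostPath, mul_assoc, aux_vv]

theorem aux_path_app {u v : G.V} {a : List G.E} (ha : IsPathFrom G u a v) (b : List G.E) :
    uPath R G u (a ++ b) = uPath R G u a * uPath R G v b := by
  induction ha with
  | nil v => rw [aux_path_nil, aux_v_path]; rfl
  | cons e h ht ih =>
    subst h
    rw [List.cons_append, aux_path_cons, aux_path_cons, ih, mul_assoc]

theorem aux_path_mul_ne {u v v' : G.V} {a : List G.E} (ha : IsPathFrom G u a v) (h : v ≠ v')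
    (b : List G.E) : uPath R G u a * uPath R G v' b = 0 := by
  have := aux_path_app (R := R) ha []
  rw [List.append_nil, aux_path_nil] at this
  rw [this, mul_assoc, aux_v_path_ne h, mul_zero]

theorem aux_gpath_app {u v : G.V} {a : List G.E} (ha : IsPathFrom G u a v) (b : List G.E) :
    uGhostPath R G u (a ++ b) = uGhostPath R G v b * uGhostPath R G u a := by
  induction ha with
  | nil v => rw [aux_gpath_nil, aux_gpath_v]; rfl
  | cons e h ht ih =>
    subst h
    rw [List.cons_append, aux_gpath_cons, aux_gpath_cons, ih, mul_assoc]

theorem aux_gpath_mul_ne {u u' : G.V} (h : u ≠ u') (a b : List G.E) :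
    uGhostPath R G u a * uPath R G u' b = 0 := by
  rw [← aux_gpath_v, mul_assoc, aux_v_path_ne h, mul_zero]

theorem aux_gp_self {u w : G.V} {a : List G.E} (ha : IsPathFrom G u a w) :
    uGhostPath R G u a * uPath R G u a = ugen R G (LGen.vert w) := by
  induction ha with
  | nil v => rw [aux_gpath_nil, aux_path_nil, aux_vv]
  | cons e h ht ih =>
    subst h
    rw [aux_gpath_cons, aux_path_cons, mul_assoc, ← mul_assoc (ugen R G (LGen.ghost e)),
      aux_ge, aux_v_path, ih]

theorem aux_gp_app {u w : G.V} {a : List G.E} (ha : IsPathFrom G u a w) (d : List G.E) :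
    uGhostPath R G u a * uPath R G u (a ++ d) = uPath R G w d := by
  rw [aux_path_app ha, ← mul_assoc, aux_gp_self ha, aux_v_path]

theorem aux_gp_zero {u w : G.V} {a : List G.E} (ha : IsPathFrom G u a w) :
    ∀ {w' : G.V} {b : List G.E}, IsPathFrom G u b w' → a.length ≤ b.length → ¬ a <+: b →
      uGhostPath R G u a * uPath R G u b = 0 := by
  induction ha with
  | nil v => intro w' b _ _ h; exact absurd List.nil_prefix h
  | cons e h ht ih =>
    subst h
    intro w' b hb hl hp
    generalize hu : G.src e = u at hb
    cases hb with
    | nil => simp at hl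
    | cons f hf hbt =>
      subst hu
      rw [aux_gpath_cons, ← hf, aux_path_cons, mul_assoc, ← mul_assoc (ugen R G (LGen.ghost e))]
      by_cases hef : e = f
      · subst hef
        rw [aux_ge, aux_v_path]
        refine ih hbt (by simpa using hl) fun h => hp ?_
        exact (List.prefix_cons_inj e).2 h
      · rw [aux_gf hef, zero_mul, mul_zero]

theorem aux_isPath_app {u v w : G.V} {a b : List G.E} (ha : IsPathFrom G u a v)
    (hb : IsPathFrom G v b w) : IsPathFrom G u (a ++ b) w := by
  induction ha with
  | nil v => exact hb
  | cons e h ht ih => exact IsPathFrom.cons e h (ih hb)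

theorem aux_isPath_split {u v w : G.V} {a b : List G.E} (ha : IsPathFrom G u a v)
    (h : IsPathFrom G u (a ++ b) w) : IsPathFrom G v b w := by
  induction ha with
  | nil v => exact h
  | cons e h' ht ih =>
    cases h with
    | cons _ _ h2 => exact ih h2

theorem aux_isPath_take {u w : G.V} {a : List G.E} (ha : IsPathFrom G u a w) :
    ∀ (i : ℕ) (hi : i < a.length), IsPathFrom G u (a.take i) (G.src a[i]) := by
  induction ha with
  | nil v => intro i hi; simp at hi
  | cons e h ht ih =>
    intro i hi
    cases i with
    | zero => simpa [h] using IsPathFrom.nil _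
    | succ i => exact IsPathFrom.cons e h (ih i (by simpa using hi))

/-- Using an exit, a closed path can be left. -/
theorem aux_single (hL : G.CondL) {v : G.V} {d : List G.E} (hd : d ≠ [])
    (hp : IsPathFrom G v d v) :
    ∃ (b : List G.E) (w : G.V), IsPathFrom G v b w ∧ ∀ c, ¬ b <+: d ++ c := by
  obtain ⟨f, ⟨i, hi⟩, hs, hne⟩ := hL v d hd hp
  simp only [List.get_eq_getElem] at hs hne
  refine ⟨d.take i ++ [f], G.rng f,
    aux_isPath_app (aux_isPath_take hp i hi) (IsPathFrom.cons f hs (IsPathFrom.nil _)), ?_⟩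
  rintro c ⟨t, ht⟩
  apply hne
  have h1 : (d.take i ++ [f] ++ t)[i]? = (d ++ c)[i]? := by rw [ht]
  have hlen : (d.take i).length = i := by simp; omega
  rw [List.getElem?_append_left hi, List.append_assoc, List.getElem?_append_right (by omega)] at h1
  rw [hlen] at h1
  simpa [List.getElem?_eq_getElem hi] using h1

/-- A single path that leaves finitely many closed paths simultaneously. -/
theorem aux_multi (hL : G.CondL) (v : G.V) (S : List (List G.E)) :
    ∃ (b : List G.E) (w : G.V), IsPathFrom G v b w ∧
      ∀ d ∈ S, d ≠ [] → IsPathFrom G v d v → ¬ b <+: d ++ b := by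
  induction S with
  | nil => exact ⟨[], v, IsPathFrom.nil v, by simp⟩
  | cons d S ih =>
    obtain ⟨b, w, hb, h⟩ := ih
    by_cases hc : d ≠ [] ∧ IsPathFrom G v d v ∧ b <+: d ++ b
    · obtain ⟨hd, hdp, d', hd'⟩ := hc
      have hp' : IsPathFrom G w d' w :=
        aux_isPath_split hb (by rw [hd']; exact aux_isPath_app hdp hb)
      have hd'0 : d' ≠ [] := by
        rintro rfl
        have := congrArg List.length hd'
        simp at this
        exact hd this
      obtain ⟨b', w', hb', h'⟩ := aux_single hL hd'0 hp'
      refine ⟨b ++ b', w', aux_isPath_app hb hb', ?_⟩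
      intro x hx hx0 hxp hpre
      rcases List.mem_cons.1 hx with rfl | hx
      · rw [← List.append_assoc, ← hd', List.append_assoc, List.prefix_append_right_inj] at hpre
        exact h' _ hpre
      · refine h x hx hx0 hxp ?_
        refine List.prefix_of_prefix_length_le ((List.prefix_append b b').trans hpre)
          (l₂ := x ++ b) ?_ (by simp)
        rw [← List.append_assoc]
        exact List.prefix_append _ _
    · refine ⟨b, w, hb, ?_⟩
      intro x hx hx0 hxp hpre
      rcases List.mem_cons.1 hx with rfl | hx
      · exact hc ⟨hx0, hxp, hpre⟩
      · exact h x hx hx0 hxp hpre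

/-- Formal paths: a source vertex together with a valid list of edges. -/
def AuxP (G : LPAGraph) : Type := {p : G.V × List G.E // ∃ w, IsPathFrom G p.1 p.2 w}

theorem aux_realPoly {x : LeavittPathAlgebra R G} (hx : IsRealPoly R G x) :
    ∃ c : AuxP G →₀ R, (x : Ambient R G) = ∑ p ∈ c.support, c p • uPath R G p.1.1 p.1.2 := by
  have hset : {y | ∃ (u : G.V) (es : List G.E) (w : G.V), IsPathFrom G u es w ∧
      y = pathElem R G u es} = Set.range (fun p : AuxP G => pathElem R G p.1.1 p.1.2) := by
    ext y
    constructor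
    · rintro ⟨u, es, w, h, rfl⟩
      exact ⟨⟨(u, es), w, h⟩, rfl⟩
    · rintro ⟨⟨⟨u, es⟩, w, h⟩, rfl⟩
      exact ⟨u, es, w, h, rfl⟩
  rw [IsRealPoly, hset, Finsupp.mem_span_range_iff_exists_finsupp] at hx
  obtain ⟨c, rfl⟩ := hx
  refine ⟨c, ?_⟩
  rw [Finsupp.sum, AddSubmonoidClass.coe_finset_sum]
  rfl

end Aux

end LPAGraph

open LPAGraph in
/-- **Lemma.**  Let `E` satisfy Condition (L) and `R` be a commutative ring with unit.  If
`x ∈ L_R(E)` is a nonzero polynomial in only real edges, then there exist paths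
`α, β ∈ E*` such that `α* x β = r • v` for some vertex `v ∈ E⁰` and some `r ∈ R \ {0}`. -/
theorem stmt7 (R : Type) [CommRing R] (G : LPAGraph) (hL : G.CondL)
    (x : LeavittPathAlgebra R G) (hx : IsRealPoly R G x) (hx0 : x ≠ 0) :
    ∃ (u : G.V) (es : List G.E) (wa : G.V) (u' : G.V) (es' : List G.E) (wb : G.V)
      (v : G.V) (r : R),
      IsPathFrom G u es wa ∧ IsPathFrom G u' es' wb ∧ r ≠ 0 ∧
      ghostPathElem R G u es * x * pathElem R G u' es' = r • vertexElem R G v := by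
  classical
  obtain ⟨c, hc⟩ := aux_realPoly hx
  have hne : c.support.Nonempty := by
    rw [Finset.nonempty_iff_ne_empty]
    intro h
    apply hx0
    apply Subtype.ext
    rw [hc, h]
    simp
  obtain ⟨p0, hp0, hmin⟩ := Finset.exists_min_image c.support (fun p => p.1.2.length) hne
  obtain ⟨⟨u, a⟩, v, ha⟩ := p0
  simp only at ha hmin
  obtain ⟨b, w, hb, hkill⟩ := aux_multi hL v
    (c.support.toList.map fun p => p.1.2.drop a.length)
  refine ⟨u, a ++ b, w, v, b, w, w, c ⟨(u, a), v, ha⟩, aux_isPath_app ha hb, hb,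
    Finsupp.mem_support_iff.1 hp0, ?_⟩
  apply Subtype.ext
  change uGhostPath R G u (a ++ b) * (x : Ambient R G) * uPath R G v b
    = c ⟨(u, a), v, ha⟩ • ugen R G (LGen.vert w)
  rw [hc, Finset.mul_sum, Finset.sum_mul, Finset.sum_eq_single_of_mem _ hp0]
  · rw [mul_smul_comm, smul_mul_assoc, mul_assoc]
    simp only
    rw [← aux_path_app ha, aux_gp_self (aux_isPath_app ha hb)]
  · rintro ⟨⟨u', g⟩, w', hg⟩ hp hpne
    have hlen : a.length ≤ g.length := hmin _ hp
    simp only at hg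
    rw [mul_smul_comm, smul_mul_assoc]
    simp only
    rw [aux_gpath_app ha]
    suffices h : uGhostPath R G v b * uGhostPath R G u a * uPath R G u' g * uPath R G v b = 0 by
      rw [h, smul_zero]
    by_cases hu : u = u'
    swap
    · rw [mul_assoc (uGhostPath R G v b), aux_gpath_mul_ne hu, mul_zero, zero_mul]
    subst hu
    by_cases hpre : a <+: g
    swap
    · rw [mul_assoc (uGhostPath R G v b), aux_gp_zero ha hg hlen hpre, mul_zero, zero_mul]
    obtain ⟨d, rfl⟩ := hpre
    have hd0 : d ≠ [] := by
      rintro rfl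
      apply hpne
      apply Subtype.ext
      simp
    have hdp : IsPathFrom G v d w' := aux_isPath_split ha hg
    rw [mul_assoc (uGhostPath R G v b), aux_gp_app ha, mul_assoc]
    by_cases hw : w' = v
    swap
    · rw [aux_path_mul_ne hdp hw, mul_zero]
    subst hw
    rw [← aux_path_app hdp]
    refine aux_gp_zero hb (aux_isPath_app hdp hb) (by simp) ?_
    refine hkill d ?_ hd0 hdp
    rw [List.mem_map]
    exact ⟨_, Finset.mem_toList.2 hp, by simp⟩
end
end

section
/- Let E be a graph and R a commutative ring with unit. If x ∈ L_R(E) and x ≠ 0, then there exists a path γ ∈ E* such that xγ ≠ 0 and xγ is a polynomial in only real edges. -/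
set_option maxHeartbeats 1000000
set_option synthInstance.maxHeartbeats 400000

noncomputable section

namespace LPAGraph
namespace Aux

variable {R : Type} [CommRing R] {G : LPAGraph}

/-- vertex -/
def vt (R : Type) [CommRing R] {G : LPAGraph} (v : G.V) : Ambient R G := ugen R G (LGen.vert v)
/-- edge -/
def ed (R : Type) [CommRing R] {G : LPAGraph} (e : G.E) : Ambient R G := ugen R G (LGen.edge e)
/-- ghost edge -/
def gh (R : Type) [CommRing R] {G : LPAGraph} (e : G.E) : Ambient R G := ugen R G (LGen.ghost e)

theorem vt_self (v : G.V) : vt R v * vt R v = vt R v := by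
  simpa [vt, ugen] using RingQuot.mkAlgHom_rel R (LeavittRel.vert_mul_self (R := R) v)
theorem vt_ne {v w : G.V} (h : v ≠ w) : vt R v * vt R w = 0 := by
  simpa [vt, ugen] using RingQuot.mkAlgHom_rel R (LeavittRel.vert_mul_vert (R := R) v w h)
theorem src_ed (e : G.E) : vt R (G.src e) * ed R e = ed R e := by
  simpa [vt, ed, ugen] using RingQuot.mkAlgHom_rel R (LeavittRel.src_mul_edge (R := R) e)
theorem ed_rng (e : G.E) : ed R e * vt R (G.rng e) = ed R e := by
  simpa [vt, ed, ugen] using RingQuot.mkAlgHom_rel R (LeavittRel.edge_mul_rng (R := R) e)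
theorem rng_gh (e : G.E) : vt R (G.rng e) * gh R e = gh R e := by
  simpa [vt, gh, ugen] using RingQuot.mkAlgHom_rel R (LeavittRel.rng_mul_ghost (R := R) e)
theorem gh_src (e : G.E) : gh R e * vt R (G.src e) = gh R e := by
  simpa [vt, gh, ugen] using RingQuot.mkAlgHom_rel R (LeavittRel.ghost_mul_src (R := R) e)
theorem gh_ed (e : G.E) : gh R e * ed R e = vt R (G.rng e) := by
  simpa [vt, gh, ed, ugen] using RingQuot.mkAlgHom_rel R (LeavittRel.ghost_mul_self (R := R) e)
theorem gh_ed_ne {e f : G.E} (h : e ≠ f) : gh R e * ed R f = 0 := by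
  simpa [gh, ed, ugen] using RingQuot.mkAlgHom_rel R (LeavittRel.ghost_mul_edge (R := R) e f h)
theorem ck (v : G.V) (s : Finset G.E) (hs : ∀ e : G.E, e ∈ s ↔ G.src e = v) (hne : s.Nonempty) :
    vt R v = ∑ e ∈ s, ed R e * gh R e := by
  simpa [vt, gh, ed, ugen] using RingQuot.mkAlgHom_rel R (LeavittRel.ck (R := R) v s hs hne)

theorem vt_ed_ne {v : G.V} {e : G.E} (h : v ≠ G.src e) : vt R v * ed R e = 0 := by
  rw [← src_ed, ← mul_assoc, vt_ne h, zero_mul]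
theorem ed_vt_ne {v : G.V} {e : G.E} (h : G.rng e ≠ v) : ed R e * vt R v = 0 := by
  rw [← ed_rng, mul_assoc, vt_ne h, mul_zero]
theorem gh_vt_ne {v : G.V} {e : G.E} (h : G.src e ≠ v) : gh R e * vt R v = 0 := by
  rw [← gh_src, mul_assoc, vt_ne h, mul_zero]

theorem uPath_nil (v : G.V) : uPath R G v [] = vt R v := by simp [uPath, vt]
theorem uPath_cons (e : G.E) (es : List G.E) :
    uPath R G (G.src e) (e :: es) = ed R e * uPath R G (G.rng e) es := by
  have h1 : ugen R G (LGen.vert (G.src e)) * ugen R G (LGen.edge e) = ugen R G (LGen.edge e) :=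
    src_ed (R := R) e
  have h2 : ugen R G (LGen.edge e) * ugen R G (LGen.vert (G.rng e)) = ugen R G (LGen.edge e) :=
    ed_rng (R := R) e
  simp only [uPath, List.map_cons, List.prod_cons, ed]
  rw [← mul_assoc, ← mul_assoc, h1, h2]

theorem uPath_vt {u w : G.V} {es : List G.E} (h : IsPathFrom G u es w) :
    uPath R G u es * vt R w = uPath R G u es := by
  induction h with
  | nil v => rw [uPath_nil, vt_self]
  | cons e h ht ih => subst h; rw [uPath_cons, mul_assoc, ih]

theorem uPath_vt_ne {u w v : G.V} {es : List G.E} (h : IsPathFrom G u es w) (hv : w ≠ v) :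
    uPath R G u es * vt R v = 0 := by
  rw [← uPath_vt h, mul_assoc, vt_ne hv, mul_zero]

theorem path_snoc {u w : G.V} {es : List G.E} (h : IsPathFrom G u es w) (e : G.E)
    (he : G.src e = w) : IsPathFrom G u (es ++ [e]) (G.rng e) ∧
      uPath R G u es * ed R e = uPath R G u (es ++ [e]) := by
  induction h with
  | nil v =>
    subst he
    refine ⟨.cons e rfl (.nil _), ?_⟩
    rw [uPath_nil, List.nil_append, uPath_cons, uPath_nil, src_ed, ed_rng]
  | cons f h ht ih =>
    subst h
    obtain ⟨a, b⟩ := ih he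
    refine ⟨.cons f rfl a, ?_⟩
    rw [uPath_cons, mul_assoc, b, List.cons_append, uPath_cons]

/-- span of real paths -/
def P (R : Type) [CommRing R] (G : LPAGraph) : Submodule R (Ambient R G) :=
  Submodule.span R {y | ∃ (u : G.V) (es : List G.E) (w : G.V), IsPathFrom G u es w ∧
    y = uPath R G u es}

/-- span of real paths ending at a vertex -/
def PV (R : Type) [CommRing R] {G : LPAGraph} (v : G.V) : Submodule R (Ambient R G) :=
  Submodule.span R (Set.range fun q : {q : G.V × List G.E // IsPathFrom G q.1 q.2 v} =>
    uPath R G q.1.1 q.1.2)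

/-- filtration by the length of the ghost part -/
def M (R : Type) [CommRing R] (G : LPAGraph) : ℕ → Submodule R (Ambient R G)
  | 0 => P R G
  | n + 1 => P R G ⊔ Submodule.span R {z | ∃ y ∈ M R G n, ∃ e : G.E, z = y * gh R e}

theorem PV_le (v : G.V) : PV R v ≤ P R G := by
  refine Submodule.span_mono ?_
  rintro _ ⟨⟨⟨u, es⟩, h⟩, rfl⟩
  exact ⟨u, es, v, h, rfl⟩

theorem P_le_M (n : ℕ) : P R G ≤ M R G n := by
  cases n with
  | zero => exact le_rfl
  | succ n => exact le_sup_left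

theorem M_gh {n : ℕ} {y : Ambient R G} (hy : y ∈ M R G n) (e : G.E) :
    y * gh R e ∈ M R G (n + 1) :=
  (le_sup_right : _ ≤ M R G (n + 1)) (Submodule.subset_span ⟨y, hy, e, rfl⟩)

theorem M_induct {n : ℕ} {C : Ambient R G → Prop} (hz : C 0)
    (hadd : ∀ a b, C a → C b → C (a + b)) (hsmul : ∀ (r : R) a, C a → C (r • a))
    (hp : ∀ u es w, IsPathFrom G u es w → C (uPath R G u es))
    (hg : ∀ y ∈ M R G n, ∀ e : G.E, C (y * gh R e)) :
    ∀ x ∈ M R G (n + 1), C x := by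
  let S : Submodule R (Ambient R G) :=
    { carrier := {x | C x}, zero_mem' := hz, add_mem' := fun {a b} ha hb => hadd a b ha hb,
      smul_mem' := fun r a ha => hsmul r a ha }
  have : M R G (n + 1) ≤ S := by
    refine sup_le (Submodule.span_le.2 ?_) (Submodule.span_le.2 ?_)
    · rintro _ ⟨u, es, w, h, rfl⟩
      exact hp u es w h
    · rintro _ ⟨y, hy, e, rfl⟩
      exact hg y hy e
  exact fun x hx => this hx

theorem P_vt {x : Ambient R G} (hx : x ∈ P R G) (v : G.V) : x * vt R v ∈ PV R v := by
  refine Submodule.span_induction (p := fun x _ => x * vt R v ∈ PV R v) ?_ ?_ ?_ ?_ hx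
  · rintro _ ⟨u, es, w, h, rfl⟩
    by_cases hw : w = v
    · subst hw
      rw [uPath_vt h]
      exact Submodule.subset_span ⟨⟨(u, es), h⟩, rfl⟩
    · rw [uPath_vt_ne h hw]; exact zero_mem _
  · simp
  · intro a b _ _ ha hb
    rw [add_mul]; exact add_mem ha hb
  · intro r a _ ha
    rw [smul_mul_assoc]; exact Submodule.smul_mem _ _ ha

theorem P_ed {x : Ambient R G} (hx : x ∈ P R G) (e : G.E) : x * ed R e ∈ P R G := by
  refine Submodule.span_induction (p := fun x _ => x * ed R e ∈ P R G) ?_ ?_ ?_ ?_ hx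
  · rintro _ ⟨u, es, w, h, rfl⟩
    by_cases hw : G.src e = w
    · obtain ⟨a, b⟩ := path_snoc (R := R) h e hw
      rw [b]
      exact Submodule.subset_span ⟨_, _, _, a, rfl⟩
    · rw [← uPath_vt h, mul_assoc, vt_ed_ne (Ne.symm hw), mul_zero]; exact zero_mem _
  · simp
  · intro a b _ _ ha hb
    rw [add_mul]; exact add_mem ha hb
  · intro r a _ ha
    rw [smul_mul_assoc]; exact Submodule.smul_mem _ _ ha

theorem M_mono_succ (n : ℕ) : M R G n ≤ M R G (n + 1) := by
  induction n with
  | zero => exact le_sup_left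
  | succ n ih =>
    refine sup_le_sup le_rfl (Submodule.span_mono ?_)
    rintro _ ⟨y, hy, e, rfl⟩
    exact ⟨y, ih hy, e, rfl⟩

theorem M_mono : Monotone (M R G) := monotone_nat_of_le_succ M_mono_succ

theorem M_vt {n : ℕ} {x : Ambient R G} (hx : x ∈ M R G n) (v : G.V) :
    x * vt R v ∈ M R G n := by
  cases n with
  | zero => exact PV_le v (P_vt hx v)
  | succ n =>
    refine M_induct (C := fun x => x * vt R v ∈ M R G (n + 1)) ?_ ?_ ?_ ?_ ?_ x hx
    · simp
    · intro a b ha hb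
      rw [add_mul]; exact add_mem ha hb
    · intro r a ha
      rw [smul_mul_assoc]; exact Submodule.smul_mem _ _ ha
    · intro u es w h
      exact P_le_M _ (PV_le v (P_vt (Submodule.subset_span ⟨_, _, _, h, rfl⟩) v))
    · intro y hy e
      by_cases h : G.src e = v
      · subst h
        rw [mul_assoc, gh_src]; exact M_gh hy e
      · rw [mul_assoc, gh_vt_ne h, mul_zero]; exact zero_mem _

theorem M_succ_ed {n : ℕ} {x : Ambient R G} (hx : x ∈ M R G (n + 1)) (e : G.E) :
    x * ed R e ∈ M R G n := by
  refine M_induct (C := fun x => x * ed R e ∈ M R G n) ?_ ?_ ?_ ?_ ?_ x hx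
  · simp
  · intro a b ha hb
    rw [add_mul]; exact add_mem ha hb
  · intro r a ha
    rw [smul_mul_assoc]; exact Submodule.smul_mem _ _ ha
  · intro u es w h
    exact P_le_M _ (P_ed (Submodule.subset_span ⟨_, _, _, h, rfl⟩) e)
  · intro y hy f
    by_cases h : f = e
    · subst h
      rw [mul_assoc, gh_ed]; exact M_vt hy _
    · rw [mul_assoc, gh_ed_ne h, mul_zero]; exact zero_mem _

theorem vt_mem_P (v : G.V) : vt R v ∈ P R G := by
  rw [← uPath_nil]
  exact Submodule.subset_span ⟨v, [], v, .nil v, rfl⟩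

theorem mul_gen {n : ℕ} {x : Ambient R G} (hx : x ∈ M R G n) (g : LGen G) :
    x * ugen R G g ∈ M R G (n + 1) := by
  cases g with
  | vert v => exact M_mono_succ n (M_vt hx v)
  | edge e => exact M_mono_succ n (M_succ_ed (M_mono_succ n hx) e)
  | ghost e => exact M_gh hx e

theorem gen_mem (g : LGen G) : ugen R G g ∈ M R G 1 := by
  cases g with
  | vert v => exact P_le_M 1 (vt_mem_P v)
  | edge e =>
    have h : ed R e ∈ P R G := by
      rw [← src_ed]; exact P_ed (vt_mem_P _) e
    exact P_le_M 1 h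
  | ghost e =>
    have h := M_gh (n := 0) (vt_mem_P (R := R) (G.rng e)) e
    rw [rng_gh] at h
    exact h

theorem mem_M_of_mem {y : Ambient R G} (hy : y ∈ LeavittSubalgebra R G) :
    (∃ n, y ∈ M R G n) ∧ ∀ x, (∃ n, x ∈ M R G n) → ∃ n, x * y ∈ M R G n := by
  refine NonUnitalAlgebra.adjoin_induction (p := fun y _ => (∃ n, y ∈ M R G n) ∧
    ∀ x, (∃ n, x ∈ M R G n) → ∃ n, x * y ∈ M R G n) ?_ ?_ ?_ ?_ ?_ hy
  · rintro _ ⟨g, rfl⟩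
    exact ⟨⟨1, gen_mem g⟩, fun x ⟨n, hn⟩ => ⟨n + 1, mul_gen hn g⟩⟩
  · rintro a b _ _ ⟨⟨n, hn⟩, ha⟩ ⟨⟨m, hm⟩, hb⟩
    refine ⟨⟨max n m, add_mem (M_mono (le_max_left _ _) hn) (M_mono (le_max_right _ _) hm)⟩, ?_⟩
    intro x hx
    obtain ⟨n, hn⟩ := ha x hx
    obtain ⟨m, hm⟩ := hb x hx
    refine ⟨max n m, ?_⟩
    rw [mul_add]
    exact add_mem (M_mono (le_max_left _ _) hn) (M_mono (le_max_right _ _) hm)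
  · exact ⟨⟨0, zero_mem _⟩, fun x _ => ⟨0, by rw [mul_zero]; exact zero_mem _⟩⟩
  · rintro a b _ _ ⟨ha, ha'⟩ ⟨_, hb'⟩
    refine ⟨hb' a ha, fun x hx => ?_⟩
    rw [← mul_assoc]
    exact hb' _ (ha' x hx)
  · rintro r a _ ⟨⟨n, hn⟩, ha⟩
    refine ⟨⟨n, Submodule.smul_mem _ _ hn⟩, fun x hx => ?_⟩
    obtain ⟨n, hn⟩ := ha x hx
    exact ⟨n, by rw [mul_smul_comm]; exact Submodule.smul_mem _ _ hn⟩

theorem local_unit {y : Ambient R G} (hy : y ∈ LeavittSubalgebra R G) :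
    ∃ F : Finset G.V, ∀ F', F ⊆ F' → y * ∑ v ∈ F', vt R v = y := by
  classical
  have key : ∀ (y : Ambient R G) (w : G.V), y * vt R w = y →
      ∃ F : Finset G.V, ∀ F', F ⊆ F' → y * ∑ v ∈ F', vt R v = y := by
    intro y w h
    refine ⟨{w}, fun F' hF => ?_⟩
    rw [Finset.mul_sum, Finset.sum_eq_single_of_mem w (hF (by simp))]
    · exact h
    · intro b _ hb
      rw [← h, mul_assoc, vt_ne (Ne.symm hb), mul_zero]
  refine NonUnitalAlgebra.adjoin_induction (p := fun y _ => ∃ F : Finset G.V,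
    ∀ F', F ⊆ F' → y * ∑ v ∈ F', vt R v = y) ?_ ?_ ?_ ?_ ?_ hy
  · rintro _ ⟨g, rfl⟩
    cases g with
    | vert v => exact key _ v (vt_self v)
    | edge e => exact key _ _ (ed_rng e)
    | ghost e => exact key _ _ (gh_src e)
  · rintro a b _ _ ⟨F, hF⟩ ⟨K, hK⟩
    refine ⟨F ∪ K, fun F' h => ?_⟩
    rw [add_mul, hF F' (Finset.union_subset_left h), hK F' (Finset.union_subset_right h)]
  · exact ⟨∅, fun _ _ => by simp⟩
  · rintro a b _ _ _ ⟨K, hK⟩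
    exact ⟨K, fun F' h => by rw [mul_assoc, hK F' h]⟩
  · rintro r a _ ⟨F, hF⟩
    exact ⟨F, fun F' h => by rw [smul_mul_assoc, hF F' h]⟩

theorem exists_vt {y : Ambient R G} (hy : y ∈ LeavittSubalgebra R G) (h0 : y ≠ 0) :
    ∃ v, y * vt R v ≠ 0 := by
  by_contra! h
  obtain ⟨F, hF⟩ := local_unit hy
  apply h0
  rw [← hF F le_rfl, Finset.mul_sum]
  exact Finset.sum_eq_zero fun v _ => h v

theorem decomp {n : ℕ} (v : G.V) : ∀ x ∈ M R G (n + 1),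
    ∃ p ∈ PV R v, ∃ F : Finset G.E,
      (∀ F', F ⊆ F' → x * vt R v + ∑ e ∈ F', p * ed R e * gh R e =
        p + ∑ e ∈ F', x * vt R v * ed R e * gh R e) ∧
      ∀ e, e ∉ F → x * vt R v * ed R e = p * ed R e := by
  classical
  refine M_induct ?_ ?_ ?_ ?_ ?_
  · exact ⟨0, zero_mem _, ∅, by simp, by simp⟩
  · rintro a b ⟨p, hp, F, h1, h2⟩ ⟨q, hq, K, h3, h4⟩
    refine ⟨p + q, add_mem hp hq, F ∪ K, fun F' h => ?_, fun e he => ?_⟩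
    · have e1 := h1 F' (Finset.union_subset_left h)
      have e2 := h3 F' (Finset.union_subset_right h)
      simp only [add_mul, Finset.sum_add_distrib]
      rw [add_add_add_comm, e1, e2, add_add_add_comm]
    · simp only [Finset.mem_union, not_or] at he
      rw [add_mul, add_mul, add_mul, h2 e he.1, h4 e he.2]
  · rintro r a ⟨p, hp, F, h1, h2⟩
    refine ⟨r • p, Submodule.smul_mem _ _ hp, F, fun F' h => ?_, fun e he => ?_⟩
    · simp only [smul_mul_assoc]
      rw [← Finset.smul_sum, ← Finset.smul_sum, ← smul_add, ← smul_add, h1 F' h]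
    · simp only [smul_mul_assoc]
      rw [h2 e he]
  · intro u es w h
    exact ⟨_, P_vt (Submodule.subset_span ⟨_, _, _, h, rfl⟩) v, ∅, by simp, by simp⟩
  · intro y _ f
    by_cases hf : G.src f = v
    · subst hf
      refine ⟨0, zero_mem _, {f}, fun F' h => ?_, fun e he => ?_⟩
      · simp only [zero_mul, Finset.sum_const_zero]
        rw [Finset.sum_eq_single_of_mem f (h (by simp))]
        · rw [mul_assoc y, gh_src, mul_assoc y, gh_ed, mul_assoc y, rng_gh]
          simp
        · intro e _ he
          rw [mul_assoc y, gh_src, mul_assoc y, gh_ed_ne (Ne.symm he)]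
          simp
      · rw [mul_assoc y, gh_src, mul_assoc y, gh_ed_ne (by simpa [eq_comm] using he)]
        simp
    · have : y * gh R f * vt R v = 0 := by rw [mul_assoc, gh_vt_ne hf, mul_zero]
      exact ⟨0, zero_mem _, ∅, by simp [this], by simp [this]⟩

/-! ### The representation -/

theorem exists_coding (G : LPAGraph) : ∃ (enc : G.E → ℕ → ℕ) (dec : G.V → ℕ → Option (G.E × ℕ)),
    (∀ w n e m, dec w n = some (e, m) ↔ G.src e = w ∧ enc e m = n) ∧
    ∀ e n, dec (G.src e) n ≠ none := by
  classical
  have h : ∀ v : G.V, ∃ f : {e : G.E // G.src e = v} × ℕ → ℕ, Function.Injective f ∧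
      (Nonempty {e : G.E // G.src e = v} → Function.Surjective f) := by
    intro v
    have := G.countE
    by_cases hne : Nonempty {e : G.E // G.src e = v}
    · obtain ⟨d⟩ := nonempty_denumerable ({e : G.E // G.src e = v} × ℕ)
      exact ⟨Denumerable.eqv _, (Denumerable.eqv _).injective,
        fun _ => (Denumerable.eqv _).surjective⟩
    · rw [not_nonempty_iff] at hne
      exact ⟨fun _ => 0, fun a => (hne.false a.1).elim, fun ⟨a⟩ => (hne.false a).elim⟩
  choose f hi hs using h
  refine ⟨fun e m => f (G.src e) (⟨e, rfl⟩, m),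
    fun w n => if h : ∃ q, f w q = n then some (h.choose.1.1, h.choose.2) else none, ?_, ?_⟩
  · intro w n e m
    by_cases h : ∃ q, f w q = n
    · simp only [h, dif_pos, Option.some.injEq, Prod.mk.injEq]
      constructor
      · rintro ⟨rfl, rfl⟩
        have h1 := h.choose_spec
        generalize h.choose = q at h1
        obtain ⟨⟨e, he⟩, m⟩ := q
        subst he
        exact ⟨rfl, h1⟩
      · rintro ⟨rfl, h2⟩
        have h1 := h.choose_spec
        have h3 := hi _ (h1.trans h2.symm)
        have h4 : ∀ q q' : {e' : G.E // G.src e' = G.src e} × ℕ, q = q' →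
          q.1.1 = q'.1.1 ∧ q.2 = q'.2 := by rintro q _ rfl; exact ⟨rfl, rfl⟩
        exact h4 _ _ h3
    · simp only [h, dif_neg, not_false_eq_true, reduceCtorEq, false_iff]
      rintro ⟨rfl, h2⟩
      exact h ⟨_, h2⟩
  · intro e n
    have h : ∃ q, f (G.src e) q = n := hs _ ⟨⟨e, rfl⟩⟩ n
    simp only [h, dif_pos, ne_eq, reduceCtorEq, not_false_eq_true]

/-- encoding of edges -/
def enc (G : LPAGraph) : G.E → ℕ → ℕ := (exists_coding G).choose
/-- decoding -/
def dec (G : LPAGraph) : G.V → ℕ → Option (G.E × ℕ) := (exists_coding G).choose_spec.choose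
theorem dec_iff {w : G.V} {n : ℕ} {e : G.E} {m : ℕ} :
    dec G w n = some (e, m) ↔ G.src e = w ∧ enc G e m = n :=
  (exists_coding G).choose_spec.choose_spec.1 w n e m
theorem dec_ne (e : G.E) (n : ℕ) : dec G (G.src e) n ≠ none :=
  (exists_coding G).choose_spec.choose_spec.2 e n
theorem dec_enc (e : G.E) (m : ℕ) : dec G (G.src e) (enc G e m) = some (e, m) :=
  dec_iff.2 ⟨rfl, rfl⟩

/-- basis points of the representation -/
abbrev X (G : LPAGraph) : Type := G.V × ℕ × ℤ

open Classical in
/-- vertex operator -/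
def opV (R : Type) [CommRing R] {G : LPAGraph} (v : G.V) : Module.End R (X G → R) where
  toFun f x := if x.1 = v then f x else 0
  map_add' f g := by funext x; by_cases h : x.1 = v <;> simp [h]
  map_smul' r f := by funext x; by_cases h : x.1 = v <;> simp [h]

open Classical in
/-- ghost operator -/
def opG (R : Type) [CommRing R] {G : LPAGraph} (e : G.E) : Module.End R (X G → R) where
  toFun f x := if x.1 = G.rng e then f (G.src e, enc G e x.2.1, x.2.2 + 1) else 0
  map_add' f g := by funext x; by_cases h : x.1 = G.rng e <;> simp [h]
  map_smul' r f := by funext x; by_cases h : x.1 = G.rng e <;> simp [h]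

open Classical in
/-- value of the edge operator -/
def edVal {R : Type} [CommRing R] {G : LPAGraph} (e : G.E) (f : X G → R) (d : ℤ) :
    Option (G.E × ℕ) → R
  | none => 0
  | some q => if q.1 = e then f (G.rng e, q.2, d - 1) else 0

/-- edge operator -/
def opE (R : Type) [CommRing R] {G : LPAGraph} (e : G.E) : Module.End R (X G → R) where
  toFun f x := edVal e f x.2.2 (dec G x.1 x.2.1)
  map_add' f g := by
    funext x
    rcases h : dec G x.1 x.2.1 with _ | q
    · simp [h, edVal]
    · by_cases hq : q.1 = e <;> simp [h, edVal, hq]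
  map_smul' r f := by
    funext x
    rcases h : dec G x.1 x.2.1 with _ | q
    · simp [h, edVal]
    · by_cases hq : q.1 = e <;> simp [h, edVal, hq]

/-- operators of all generators -/
def op (R : Type) [CommRing R] {G : LPAGraph} : LGen G → Module.End R (X G → R)
  | .vert v => opV R v
  | .edge e => opE R e
  | .ghost e => opG R e

theorem opV_apply (v : G.V) (f : X G → R) (w n d) [Decidable (w = v)] :
    opV R v f (w, n, d) = if w = v then f (w, n, d) else 0 := by
  simp only [opV, LinearMap.coe_mk, AddHom.coe_mk]; congr
theorem opG_apply (e : G.E) (f : X G → R) (w n d) [Decidable (w = G.rng e)] :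
    opG R e f (w, n, d) = if w = G.rng e then f (G.src e, enc G e n, d + 1) else 0 := by
  simp only [opG, LinearMap.coe_mk, AddHom.coe_mk]
theorem opE_apply (e : G.E) (f : X G → R) (w n d) :
    opE R e f (w, n, d) = edVal e f d (dec G w n) := rfl

theorem op_rel {a b : FreeAlgebra R (LGen G)} (h : LeavittRel R G a b) :
    FreeAlgebra.lift R (op R) a = FreeAlgebra.lift R (op R) b := by
  classical
  have ext' : ∀ S T : Module.End R (X G → R),
      (∀ f w n d, S f (w, n, d) = T f (w, n, d)) → S = T := by
    intro S T h
    refine LinearMap.ext fun f => ?_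
    funext ⟨w, n, d⟩
    exact h f w n d
  cases h with
  | vert_mul_self v =>
    refine ext' _ _ fun f w n d => ?_
    simp only [map_mul, FreeAlgebra.lift_ι_apply, op, Module.End.mul_apply, opV_apply]
    split_ifs <;> rfl
  | vert_mul_vert v w' hvw =>
    refine ext' _ _ fun f w n d => ?_
    simp only [map_mul, FreeAlgebra.lift_ι_apply, op, Module.End.mul_apply, opV_apply, map_zero,
      LinearMap.zero_apply, Pi.zero_apply]
    split_ifs with h1 h2
    · exact (hvw (h1.symm.trans h2)).elim
    · rfl
    · rfl
  | src_mul_edge e =>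
    refine ext' _ _ fun f w n d => ?_
    simp only [map_mul, FreeAlgebra.lift_ι_apply, op, Module.End.mul_apply, opV_apply, opE_apply]
    split_ifs with h1
    · rfl
    · rcases h : dec G w n with _ | ⟨e', m⟩
      · rfl
      · have := (dec_iff.1 h).1
        simp only [edVal]
        rw [if_neg]
        rintro rfl
        exact h1 this.symm
  | edge_mul_rng e =>
    refine ext' _ _ fun f w n d => ?_
    simp only [map_mul, FreeAlgebra.lift_ι_apply, op, Module.End.mul_apply, opE_apply]
    rcases h : dec G w n with _ | ⟨e', m⟩
    · rfl
    · simp [edVal, opV_apply]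
  | rng_mul_ghost e =>
    refine ext' _ _ fun f w n d => ?_
    simp only [map_mul, FreeAlgebra.lift_ι_apply, op, Module.End.mul_apply, opV_apply, opG_apply]
    split_ifs <;> rfl
  | ghost_mul_src e =>
    refine ext' _ _ fun f w n d => ?_
    simp only [map_mul, FreeAlgebra.lift_ι_apply, op, Module.End.mul_apply, opV_apply, opG_apply]
    simp
  | ghost_mul_self e =>
    refine ext' _ _ fun f w n d => ?_
    simp only [map_mul, FreeAlgebra.lift_ι_apply, op, Module.End.mul_apply, opV_apply, opG_apply,
      opE_apply, dec_enc, edVal]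
    split_ifs with h
    · simp [h]
    · rfl
  | ghost_mul_edge e f' hef =>
    refine ext' _ _ fun f w n d => ?_
    simp only [map_mul, FreeAlgebra.lift_ι_apply, op, Module.End.mul_apply, opG_apply,
      opE_apply, dec_enc, edVal, map_zero, LinearMap.zero_apply, Pi.zero_apply]
    simp [hef]
  | ck v s hs hne =>
    refine ext' _ _ fun f w n d => ?_
    simp only [map_mul, map_sum, FreeAlgebra.lift_ι_apply, op, Module.End.mul_apply, opV_apply,
      LinearMap.sum_apply, Finset.sum_apply, opE_apply]
    rcases h : dec G w n with _ | ⟨e', m⟩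
    · simp only [edVal, Finset.sum_const_zero]
      rw [if_neg]
      rintro rfl
      obtain ⟨e, he⟩ := hne
      have := dec_ne e n
      rw [(hs e).1 he] at this
      exact this h
    · obtain ⟨h1, h2⟩ := dec_iff.1 h
      simp only [edVal, opG_apply]
      by_cases hw : w = v
      · rw [Finset.sum_eq_single_of_mem e' ((hs e').2 (h1.trans hw))]
        · simp [hw, h2, h1.trans hw]
        · intro b _ hb
          simp [Ne.symm hb]
      · rw [if_neg hw, Finset.sum_eq_zero]
        intro b hb
        rw [if_neg]
        rintro rfl
        exact hw (h1.symm.trans ((hs _).1 hb))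

/-- the representation -/
def rho (R : Type) [CommRing R] (G : LPAGraph) : Ambient R G →ₐ[R] Module.End R (X G → R) :=
  RingQuot.liftAlgHom R ⟨FreeAlgebra.lift R (op R), fun _ _ h => op_rel h⟩

theorem rho_gen (g : LGen G) : rho R G (ugen R G g) = op R g := by
  simp [rho, ugen]

/-- action of a path on points -/
def encP (b : X G) : List G.E → X G
  | [] => b
  | e :: es => (G.src e, enc G e (encP b es).2.1, (encP b es).2.2 + 1)

open Classical in
/-- indicator -/
def delta (R : Type) [CommRing R] {G : LPAGraph} (b : X G) : X G → R :=
  fun x => if x = b then 1 else 0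

theorem opE_delta (e : G.E) (b : X G) (hb : b.1 = G.rng e) :
    opE R e (delta R b) = delta R (G.src e, enc G e b.2.1, b.2.2 + 1) := by
  classical
  funext ⟨w, n, d⟩
  obtain ⟨b1, b2, b3⟩ := b
  simp only at hb
  subst hb
  rw [opE_apply]
  simp only [delta, Prod.mk.injEq]
  rcases h : dec G w n with _ | ⟨e', m⟩
  · simp only [edVal]
    rw [if_neg]
    rintro ⟨rfl, -, -⟩
    exact dec_ne _ _ h
  · obtain ⟨rfl, rfl⟩ := dec_iff.1 h
    simp only [edVal]
    by_cases he : e' = e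
    · subst he
      simp only [if_true]
      refine if_congr ?_ rfl rfl
      simp only [Prod.mk.injEq]
      constructor
      · rintro ⟨-, rfl, rfl⟩
        simp
      · rintro ⟨-, h2, rfl⟩
        have := dec_enc e' m
        rw [h2, dec_enc] at this
        simp only [Option.some.injEq, Prod.mk.injEq, true_and] at this
        simp [this]
    · rw [if_neg he, if_neg]
      rintro ⟨h1, h2, -⟩
      have := dec_enc e' m
      rw [h1, h2, dec_enc] at this
      simp only [Option.some.injEq, Prod.mk.injEq] at this
      exact he this.1.symm

theorem opV_delta (b : X G) : opV R b.1 (delta R b) = delta R b := by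
  classical
  funext ⟨w, n, d⟩
  rw [opV_apply]
  simp only [delta]
  split_ifs with h1 h2 h2
  · rfl
  · rfl
  · subst h2; exact (h1 rfl).elim
  · rfl

theorem encP_fst {u w : G.V} {es : List G.E} (h : IsPathFrom G u es w) (b : X G)
    (hb : b.1 = w) : (encP b es).1 = u := by
  cases h with
  | nil => exact hb
  | cons e h ht => exact h

theorem rho_path {u w : G.V} {es : List G.E} (h : IsPathFrom G u es w) (b : X G)
    (hb : b.1 = w) : rho R G (uPath R G u es) (delta R b) = delta R (encP b es) := by
  induction h with
  | nil v =>
    subst hb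
    rw [uPath_nil, vt, rho_gen]
    exact opV_delta b
  | cons e h ht ih =>
    subst h
    rw [uPath_cons, map_mul, Module.End.mul_apply, ih hb, ed, rho_gen]
    exact opE_delta e _ (encP_fst ht b hb)

theorem encP_deg (b : X G) (es : List G.E) : (encP b es).2.2 = b.2.2 + es.length := by
  induction es with
  | nil => simp [encP]
  | cons e es ih => simp only [encP, ih, List.length_cons]; push_cast; ring

theorem encP_inj {w u u' : G.V} {es es' : List G.E} (h : IsPathFrom G u es w)
    (h' : IsPathFrom G u' es' w) (b : X G) (hb : b.1 = w) (heq : encP b es = encP b es') :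
    u = u' ∧ es = es' := by
  have hu : u = u' := by rw [← encP_fst h b hb, ← encP_fst h' b hb, heq]
  refine ⟨hu, ?_⟩
  have hl : es.length = es'.length := by
    have := encP_deg b es
    rw [heq, encP_deg] at this
    omega
  clear hu
  induction h generalizing u' es' with
  | nil v =>
    symm
    simpa using hl.symm
  | cons e h ht ih =>
    cases h' with
    | nil => simp at hl
    | cons e' h2 ht' =>
      simp only [encP, Prod.mk.injEq] at heq
      obtain ⟨a1, a2, a3⟩ := heq
      have := congrArg (dec G (G.src e)) a2
      rw [dec_enc, a1, dec_enc] at this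
      simp only [Option.some.injEq, Prod.mk.injEq] at this
      obtain ⟨rfl, h5⟩ := this
      congr 1
      refine ih ht' hb ?_ (by simpa using hl)
      refine Prod.ext ?_ (Prod.ext h5 (by linarith))
      rw [encP_fst ht b hb, encP_fst ht' b hb]

theorem PV_inj {v : G.V} {p : Ambient R G} (hp : p ∈ PV R v) (e : G.E) (he : G.src e = v)
    (h0 : p * ed R e = 0) : p = 0 := by
  classical
  obtain ⟨c, rfl⟩ := (Finsupp.mem_span_range_iff_exists_finsupp).1 hp
  let b : X G := (v, enc G e 0, (0 : ℤ) + 1)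
  have hz : rho R G (c.sum fun q a => a • uPath R G q.1.1 q.1.2) (delta R b) = 0 := by
    have h1 := congrArg (fun z => rho R G z (delta R (G.rng e, 0, 0))) h0
    simp only [map_mul, Module.End.mul_apply, map_zero, LinearMap.zero_apply] at h1
    rw [ed, rho_gen] at h1
    have h2 := opE_delta (R := R) e (G.rng e, 0, 0) rfl
    simp only [op] at h1
    rw [h2, he] at h1
    exact h1
  have hc : c = 0 := by
    ext q
    have h1 := congrFun hz (encP b q.1.2)
    simp only [Finsupp.sum, map_sum, map_smul, LinearMap.sum_apply, LinearMap.smul_apply,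
      Finset.sum_apply, Pi.smul_apply, Pi.zero_apply, smul_eq_mul] at h1
    rw [Finset.sum_eq_single q] at h1
    · rw [rho_path q.2 b rfl] at h1
      simpa [delta] using h1
    · intro q' _ hq
      rw [rho_path q'.2 b rfl]
      simp only [delta]
      rw [if_neg, mul_zero]
      intro h
      obtain ⟨a1, a2⟩ := encP_inj q.2 q'.2 b rfl h
      exact hq (Subtype.ext (Prod.ext a1.symm a2.symm))
    · intro hq
      simp [Finsupp.notMem_support_iff.1 hq]
  simp [hc]

theorem main (n : ℕ) : ∀ z ∈ M R G n, z ∈ LeavittSubalgebra R G → z ≠ 0 →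
    ∃ (u : G.V) (es : List G.E) (w : G.V), IsPathFrom G u es w ∧
      z * uPath R G u es ≠ 0 ∧ z * uPath R G u es ∈ P R G := by
  classical
  induction n with
  | zero =>
    intro z hz hL h0
    obtain ⟨v, hv⟩ := exists_vt hL h0
    exact ⟨v, [], v, .nil v, by rwa [uPath_nil], by rw [uPath_nil]; exact PV_le v (P_vt hz v)⟩
  | succ n ih =>
    intro z hz hL h0
    obtain ⟨v, hv⟩ := exists_vt hL h0
    by_cases hex : ∃ e, z * vt R v * ed R e ≠ 0
    · obtain ⟨e, he⟩ := hex
      have hsrc : v = G.src e := by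
        by_contra h
        apply he
        rw [mul_assoc, vt_ed_ne h, mul_zero]
      subst hsrc
      rw [mul_assoc, src_ed] at he
      obtain ⟨u, es, w, hp, h1, h2⟩ := ih (z * ed R e) (M_succ_ed hz e)
        (mul_mem hL (ugen_mem R G _)) he
      have hu : G.rng e = u := by
        by_contra h
        apply h1
        have : ed R e * uPath R G u es = 0 := by
          have h3 : ed R e * ugen R G (LGen.vert u) = 0 := ed_vt_ne h
          rw [uPath, ← mul_assoc, h3, zero_mul]
        rw [mul_assoc, this, mul_zero]
      subst hu
      rw [mul_assoc, ← uPath_cons] at h1 h2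
      exact ⟨_, _, w, .cons e rfl hp, h1, h2⟩
    · push Not at hex
      obtain ⟨p, hp, F, h1, h2⟩ := decomp v z hz
      have h3 := h1 F le_rfl
      simp only [hex, zero_mul, Finset.sum_const_zero, add_zero] at h3 h2
      by_cases hout : ∃ e, G.src e = v ∧ e ∉ F
      · obtain ⟨e, he, heF⟩ := hout
        have := PV_inj hp e he (h2 e heF).symm
        subst this
        simp at h3
        exact (hv h3).elim
      · push Not at hout
        by_cases hs : ∃ e, G.src e = v
        · exfalso
          apply hv
          obtain ⟨e, he⟩ := hs
          have hck := ck (R := R) v (F.filter fun e => G.src e = v)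
            (fun e => by
              simp only [Finset.mem_filter]
              exact ⟨fun h => h.2, fun h => ⟨hout e h, h⟩⟩)
            ⟨e, by simp [hout e he, he]⟩
          have h4 : z * vt R v = z * vt R v * vt R v := by rw [mul_assoc, vt_self]
          rw [h4]
          conv_lhs => arg 2; rw [hck]
          rw [Finset.mul_sum]
          refine Finset.sum_eq_zero fun e _ => ?_
          rw [← mul_assoc, hex, zero_mul]
        · push Not at hs
          refine ⟨v, [], v, .nil v, by rwa [uPath_nil], ?_⟩
          rw [Finset.sum_eq_zero, add_zero] at h3
          · rw [uPath_nil, h3]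
            exact PV_le v hp
          · intro e _
            have hpv : p * vt R v = p := by
              refine Submodule.span_induction (p := fun p _ => p * vt R v = p) ?_ ?_ ?_ ?_ hp
              · rintro _ ⟨q, rfl⟩
                exact uPath_vt q.2
              · simp
              · intro a b _ _ ha hb
                rw [add_mul, ha, hb]
              · intro r a _ ha
                rw [smul_mul_assoc, ha]
            rw [← hpv, mul_assoc p, vt_ed_ne (Ne.symm (hs e))]
            simp

end Aux
end LPAGraph

open LPAGraph in
/-- **Lemma.**  If `x ∈ L_R(E)` and `x ≠ 0`, then there exists a path `γ ∈ E*` such that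
`x γ ≠ 0` and `x γ` is a polynomial in only real edges. -/
theorem stmt9 (R : Type) [CommRing R] (G : LPAGraph)
    (x : LeavittPathAlgebra R G) (hx0 : x ≠ 0) :
    ∃ (u : G.V) (es : List G.E) (w : G.V), IsPathFrom G u es w ∧
      x * pathElem R G u es ≠ 0 ∧ IsRealPoly R G (x * pathElem R G u es) := by
  obtain ⟨n, hn⟩ := (Aux.mem_M_of_mem x.2).1
  obtain ⟨u, es, w, hp, h1, h2⟩ := Aux.main n x.1 hn x.2 (fun h => hx0 (Subtype.ext h))
  refine ⟨u, es, w, hp, fun h => h1 (congrArg Subtype.val h), ?_⟩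
  have key : ∀ y ∈ Aux.P R G, ∃ z : LeavittPathAlgebra R G, IsRealPoly R G z ∧ z.1 = y := by
    intro y hy
    refine Submodule.span_induction (p := fun y _ => ∃ z : LeavittPathAlgebra R G,
      IsRealPoly R G z ∧ z.1 = y) ?_ ?_ ?_ ?_ hy
    · rintro _ ⟨u, es, w, h, rfl⟩
      exact ⟨pathElem R G u es, Submodule.subset_span ⟨u, es, w, h, rfl⟩, rfl⟩
    · exact ⟨0, Submodule.zero_mem _, rfl⟩
    · rintro a b _ _ ⟨z, hz, rfl⟩ ⟨z', hz', rfl⟩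
      exact ⟨z + z', Submodule.add_mem _ hz hz', rfl⟩
    · rintro r a _ ⟨z, hz, rfl⟩
      exact ⟨r • z, Submodule.smul_mem _ r hz, rfl⟩
  obtain ⟨z, hz, hzy⟩ := key _ h2
  have : x * pathElem R G u es = z := Subtype.ext hzy.symm
  rw [this]
  exact hz
end
end

section
/- (Cuntz-Krieger Uniqueness Theorem) Let E be a graph satisfying Condition (L) and let R be a commutative ring with unit. If S is a ring and φ : L_R(E) → S is a ring homomorphism with the property that φ(rv) ≠ 0 for every vertex v ∈ E⁰ and every r ∈ R \ {0}, then φ is injective. -/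
set_option maxHeartbeats 1000000
set_option synthInstance.maxHeartbeats 400000

noncomputable section

namespace LPAGraph

namespace CK

section Paths
variable {G : LPAGraph}

theorem path_append {u v w : G.V} {a b : List G.E} (h : IsPathFrom G u a v)
    (h' : IsPathFrom G v b w) : IsPathFrom G u (a ++ b) w := by
  induction h with
  | nil v => simpa using h'
  | cons e he _ ih => exact IsPathFrom.cons e he (ih h')

theorem path_append_right {u v w : G.V} {a b : List G.E} (h : IsPathFrom G u a v)
    (h' : IsPathFrom G u (a ++ b) w) : IsPathFrom G v b w := by
  induction h with
  | nil v => simpa using h'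
  | cons e he _ ih =>
    cases h' with
    | cons _ _ h2 => exact ih h2

theorem path_take {u w : G.V} {a : List G.E} (h : IsPathFrom G u a w) :
    ∀ (i : ℕ) (hi : i < a.length), IsPathFrom G u (a.take i) (G.src a[i]) := by
  induction h with
  | nil v => intro i hi; simp at hi
  | cons e he _ ih =>
    intro i hi
    cases i with
    | zero => simp only [List.take_zero, List.getElem_cons_zero]; rw [he]; exact IsPathFrom.nil _
    | succ j =>
      simp only [List.take_succ_cons, List.getElem_cons_succ]
      exact IsPathFrom.cons e he (ih j (by simpa using hi))

theorem exists_mu_step (hL : G.CondL) {v w : G.V} {m g : List G.E} (hm : IsPathFrom G v m w)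
    (hg : g ≠ []) (hgp : IsPathFrom G v g v) :
    ∃ (n : List G.E) (w' : G.V), IsPathFrom G v (m ++ n) w' ∧ ¬ (m ++ n) <+: g ++ (m ++ n) := by
  by_cases hp : m <+: g ++ m
  · obtain ⟨nu, hnu⟩ := hp
    have hnup : IsPathFrom G w nu w := by
      apply path_append_right hm
      rw [hnu]
      exact path_append hgp hm
    have hlen : nu.length = g.length := by
      have := congrArg List.length hnu
      simp at this
      omega
    have hne : nu ≠ [] := by
      intro h0
      apply hg
      apply List.eq_nil_of_length_eq_zero
      rw [← hlen, h0]; rfl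
    obtain ⟨f, ⟨i, hi⟩, hsrc, hf⟩ := hL w nu hne hnup
    simp only [List.get_eq_getElem] at hsrc hf
    refine ⟨nu.take i ++ [f], G.rng f, ?_, ?_⟩
    · apply path_append hm
      apply path_append (path_take hnup i hi)
      exact IsPathFrom.cons f hsrc (IsPathFrom.nil _)
    · intro hpre
      rw [← List.append_assoc g, ← hnu, List.append_assoc, List.prefix_append_right_inj] at hpre
      have h1 : i < (nu.take i ++ [f]).length := by simp; omega
      have h2 := hpre.getElem h1
      rw [List.getElem_append_right (by simp), List.getElem_append_left hi] at h2
      simp at h2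
      exact hf h2
  · exact ⟨[], w, by simpa using hm, by simpa using hp⟩

theorem exists_mu (hL : G.CondL) (v : G.V) (T : Finset (List G.E)) :
    ∃ (m : List G.E) (w : G.V), IsPathFrom G v m w ∧
      ∀ g ∈ T, g ≠ [] → IsPathFrom G v g v → ¬ m <+: g ++ m := by
  classical
  induction T using Finset.induction_on with
  | empty => exact ⟨[], v, IsPathFrom.nil v, by simp⟩
  | insert g T hgT ih =>
    obtain ⟨m, w, hm, hT⟩ := ih
    by_cases hg : g ≠ [] ∧ IsPathFrom G v g v
    · obtain ⟨n, w', hn, hnp⟩ := exists_mu_step hL hm hg.1 hg.2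
      refine ⟨m ++ n, w', hn, ?_⟩
      intro g' hg' h1 h2 h3
      rcases Finset.mem_insert.1 hg' with rfl | hg'
      · exact hnp h3
      · apply hT g' hg' h1 h2
        have h4 : m <+: (g' ++ m) ++ n := by
          rw [List.append_assoc]
          exact (List.prefix_append m n).trans h3
        exact List.prefix_of_prefix_length_le h4 (List.prefix_append _ _) (by simp)
    · refine ⟨m, w, hm, ?_⟩
      intro g' hg' h1 h2
      rcases Finset.mem_insert.1 hg' with rfl | hg'
      · exact absurd ⟨h1, h2⟩ hg
      · exact hT g' hg' h1 h2

end Paths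

section Alg
variable (R : Type) [CommRing R] (G : LPAGraph)

abbrev vv (v : G.V) : Ambient R G := ugen R G (LGen.vert v)
abbrev ee (e : G.E) : Ambient R G := ugen R G (LGen.edge e)
abbrev gg (e : G.E) : Ambient R G := ugen R G (LGen.ghost e)

theorem vv_self (v : G.V) : vv R G v * vv R G v = vv R G v := by
  simpa [ugen] using RingQuot.mkAlgHom_rel R (LeavittRel.vert_mul_self (R := R) v)
theorem vv_ne {v w : G.V} (h : v ≠ w) : vv R G v * vv R G w = 0 := by
  simpa [ugen] using RingQuot.mkAlgHom_rel R (LeavittRel.vert_mul_vert (R := R) v w h)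
theorem src_ee (e : G.E) : vv R G (G.src e) * ee R G e = ee R G e := by
  simpa [ugen] using RingQuot.mkAlgHom_rel R (LeavittRel.src_mul_edge (R := R) e)
theorem ee_rng (e : G.E) : ee R G e * vv R G (G.rng e) = ee R G e := by
  simpa [ugen] using RingQuot.mkAlgHom_rel R (LeavittRel.edge_mul_rng (R := R) e)
theorem rng_gg (e : G.E) : vv R G (G.rng e) * gg R G e = gg R G e := by
  simpa [ugen] using RingQuot.mkAlgHom_rel R (LeavittRel.rng_mul_ghost (R := R) e)
theorem gg_src (e : G.E) : gg R G e * vv R G (G.src e) = gg R G e := by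
  simpa [ugen] using RingQuot.mkAlgHom_rel R (LeavittRel.ghost_mul_src (R := R) e)
theorem gg_ee (e : G.E) : gg R G e * ee R G e = vv R G (G.rng e) := by
  simpa [ugen] using RingQuot.mkAlgHom_rel R (LeavittRel.ghost_mul_self (R := R) e)
theorem gg_ee_ne {e f : G.E} (h : e ≠ f) : gg R G e * ee R G f = 0 := by
  simpa [ugen] using RingQuot.mkAlgHom_rel R (LeavittRel.ghost_mul_edge (R := R) e f h)
theorem vv_ck (v : G.V) (s : Finset G.E) (hs : ∀ e : G.E, e ∈ s ↔ G.src e = v)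
    (hne : s.Nonempty) : vv R G v = ∑ e ∈ s, ee R G e * gg R G e := by
  simpa [ugen] using RingQuot.mkAlgHom_rel R (LeavittRel.ck (R := R) v s hs hne)

theorem vv_ee_ne {v : G.V} {e : G.E} (h : v ≠ G.src e) : vv R G v * ee R G e = 0 := by
  rw [← src_ee, ← mul_assoc, vv_ne R G h, zero_mul]
theorem ee_vv_ne {v : G.V} {e : G.E} (h : G.rng e ≠ v) : ee R G e * vv R G v = 0 := by
  rw [← ee_rng, mul_assoc, vv_ne R G h, mul_zero]
theorem gg_vv_ne {v : G.V} {e : G.E} (h : G.src e ≠ v) : gg R G e * vv R G v = 0 := by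
  rw [← gg_src, mul_assoc, vv_ne R G h, mul_zero]

def pp (a : List G.E) : Ambient R G := (a.map fun e => ee R G e).prod
def qq (a : List G.E) : Ambient R G := ((a.map fun e => gg R G e).reverse).prod

theorem pp_nil : pp R G [] = 1 := by simp [pp]
theorem qq_nil : qq R G [] = 1 := by simp [qq]
theorem pp_cons (e : G.E) (a : List G.E) : pp R G (e :: a) = ee R G e * pp R G a := by simp [pp]
theorem pp_append (a b : List G.E) : pp R G (a ++ b) = pp R G a * pp R G b := by simp [pp]
theorem qq_cons (e : G.E) (a : List G.E) : qq R G (e :: a) = qq R G a * gg R G e := by simp [qq]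
theorem qq_append (a b : List G.E) : qq R G (a ++ b) = qq R G b * qq R G a := by simp [qq]

def ff (u v : G.V) (a : List G.E) : Ambient R G := vv R G u * pp R G a * vv R G v
def hh (w u : G.V) (a : List G.E) : Ambient R G := vv R G w * qq R G a * vv R G u

theorem ff_mem (u v : G.V) (a : List G.E) : ff R G u v a ∈ LeavittSubalgebra R G :=
  mul_mem (uPath_mem R G u a) (ugen_mem R G _)
theorem hh_mem (u v : G.V) (a : List G.E) : hh R G u v a ∈ LeavittSubalgebra R G := by
  unfold hh
  rw [mul_assoc]
  exact mul_mem (ugen_mem R G _) (uGhostPath_mem R G v a)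

theorem pp_path {u v : G.V} {a : List G.E} (h : IsPathFrom G u a v) :
    vv R G u * pp R G a = pp R G a * vv R G v := by
  induction h with
  | nil v => simp [pp_nil]
  | cons e he _ ih =>
    subst he
    rw [pp_cons, ← mul_assoc, src_ee, mul_assoc, ← ih, ← mul_assoc, ee_rng]

theorem ff_mul {u w v : G.V} {a b : List G.E} (h : IsPathFrom G u a w) :
    ff R G u w a * ff R G w v b = ff R G u v (a ++ b) := by
  unfold ff
  rw [pp_append]
  calc vv R G u * pp R G a * vv R G w * (vv R G w * pp R G b * vv R G v)
      = vv R G u * (pp R G a * (vv R G w * vv R G w)) * pp R G b * vv R G v := by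
        simp only [mul_assoc]
    _ = (vv R G u * vv R G u) * pp R G a * pp R G b * vv R G v := by
        rw [vv_self, ← pp_path R G h]; simp only [mul_assoc]
    _ = _ := by rw [vv_self]; simp only [mul_assoc]

theorem ff_nil (v : G.V) : ff R G v v [] = vv R G v := by simp [ff, pp_nil, vv_self]
theorem hh_nil (v : G.V) : hh R G v v [] = vv R G v := by simp [hh, qq_nil, vv_self]

theorem vv_ff (u v : G.V) (a : List G.E) : vv R G u * ff R G u v a = ff R G u v a := by
  simp only [ff, ← mul_assoc, vv_self]
theorem ff_vv (u v : G.V) (a : List G.E) : ff R G u v a * vv R G v = ff R G u v a := by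
  simp only [ff, mul_assoc, vv_self]
theorem vv_hh (u v : G.V) (a : List G.E) : vv R G u * hh R G u v a = hh R G u v a := by
  simp only [hh, ← mul_assoc, vv_self]
theorem hh_vv (u v : G.V) (a : List G.E) : hh R G u v a * vv R G v = hh R G u v a := by
  simp only [hh, mul_assoc, vv_self]

theorem ff_cons (v : G.V) (e : G.E) (a : List G.E) :
    ff R G (G.src e) v (e :: a) = ee R G e * ff R G (G.rng e) v a := by
  simp only [ff, pp_cons, ← mul_assoc, src_ee, ee_rng]
theorem ff_cons_ne {u : G.V} (v : G.V) {e : G.E} (h : u ≠ G.src e) (a : List G.E) :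
    ff R G u v (e :: a) = 0 := by
  simp only [ff, pp_cons, ← mul_assoc, vv_ee_ne R G h, zero_mul]
theorem hh_cons (v : G.V) (e : G.E) (a : List G.E) :
    hh R G v (G.src e) (e :: a) = hh R G v (G.rng e) a * gg R G e := by
  simp only [hh, qq_cons, mul_assoc, gg_src, rng_gg]
theorem hh_cons_ne {u : G.V} (v : G.V) {e : G.E} (h : G.src e ≠ u) (a : List G.E) :
    hh R G v u (e :: a) = 0 := by
  simp only [hh, qq_cons, mul_assoc, gg_vv_ne R G h, mul_zero]
theorem gg_hh (v : G.V) (e : G.E) (a : List G.E) :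
    gg R G e * hh R G (G.src e) v a = hh R G (G.rng e) v (a ++ [e]) := by
  simp only [hh, qq_append, qq_cons, qq_nil, one_mul, ← mul_assoc, gg_src, rng_gg]

theorem ff_not_path {u v : G.V} {a : List G.E} (h : ¬ IsPathFrom G u a v) :
    ff R G u v a = 0 := by
  induction a generalizing u with
  | nil =>
    have : u ≠ v := by rintro rfl; exact h (IsPathFrom.nil _)
    simp [ff, pp_nil, vv_ne R G this]
  | cons e t ih =>
    by_cases hu : G.src e = u
    · subst hu
      rw [ff_cons, ih (fun h' => h (IsPathFrom.cons e rfl h')), mul_zero]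
    · exact ff_cons_ne R G v (Ne.symm hu) t

theorem hh_ff_prefix {u w v : G.V} {a b : List G.E} (h : IsPathFrom G u a w) :
    hh R G w u a * ff R G u v (a ++ b) = ff R G w v b := by
  induction h with
  | nil v => rw [hh_nil, List.nil_append, vv_ff]
  | cons e he _ ih =>
    subst he
    rw [hh_cons, List.cons_append, ff_cons, mul_assoc, ← mul_assoc (gg R G e), gg_ee, vv_ff, ih]

theorem hh_ff_not {u w v : G.V} {a b : List G.E} (h : IsPathFrom G u a w)
    (hlen : a.length ≤ b.length) (hn : ¬ a <+: b) :
    hh R G w u a * ff R G u v b = 0 := by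
  induction h generalizing b with
  | nil v => exact absurd (List.nil_prefix) hn
  | cons e he _ ih =>
    subst he
    cases b with
    | nil => simp at hlen
    | cons f b =>
      by_cases hef : e = f
      · subst hef
        rw [hh_cons, ff_cons, mul_assoc, ← mul_assoc (gg R G e), gg_ee, vv_ff, ih]
        · simpa using hlen
        · simpa [List.cons_prefix_cons] using hn
      · by_cases hs : G.src e = G.src f
        · rw [hh_cons, hs, ff_cons, mul_assoc, ← mul_assoc (gg R G e), gg_ee_ne R G hef,
            zero_mul, mul_zero]
        · rw [ff_cons_ne R G v hs, mul_zero]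

/-- span of monomials of ghost degree at most n, from u to v -/
def MM (n : ℕ) (u v : G.V) : Submodule R (Ambient R G) :=
  Submodule.span R {x | ∃ (a b : List G.E) (w : G.V), b.length ≤ n ∧
    x = ff R G u w a * hh R G w v b}

/-- span of all monomials -/
def MA : Submodule R (Ambient R G) :=
  Submodule.span R {x | ∃ (a b : List G.E) (u w v : G.V), x = ff R G u w a * hh R G w v b}

theorem MM_mono {n m : ℕ} (h : n ≤ m) (u v : G.V) : MM R G n u v ≤ MM R G m u v := by
  apply Submodule.span_mono
  rintro x ⟨a, b, w, hb, rfl⟩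
  exact ⟨a, b, w, hb.trans h, rfl⟩

theorem MA_mono_mem (a b : List G.E) (u w v : G.V) : ff R G u w a * hh R G w v b ∈ MA R G :=
  Submodule.subset_span ⟨a, b, u, w, v, rfl⟩

theorem gen_mul (x : LGen G) (a b : List G.E) (u w v : G.V) :
    ugen R G x * (ff R G u w a * hh R G w v b) ∈ MA R G := by
  rw [← mul_assoc]
  cases x with
  | vert z =>
    by_cases hz : z = u
    · subst hz
      rw [vv_ff]; exact MA_mono_mem R G _ _ _ _ _
    · have : vv R G z * ff R G u w a = 0 := by
        simp only [ff, ← mul_assoc, vv_ne R G hz, zero_mul]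
      rw [this, zero_mul]; exact zero_mem _
  | edge e =>
    by_cases hz : G.rng e = u
    · subst hz
      rw [← ff_cons]; exact MA_mono_mem R G _ _ _ _ _
    · have : ee R G e * ff R G u w a = 0 := by
        simp only [ff, ← mul_assoc, ee_vv_ne R G hz, zero_mul]
      rw [this, zero_mul]; exact zero_mem _
  | ghost e =>
    by_cases hz : G.src e = u
    · subst hz
      cases a with
      | nil =>
        by_cases hw : G.src e = w
        · subst hw
          rw [ff_nil, gg_src, gg_hh, ← vv_hh, ← ff_nil]
          exact MA_mono_mem R G _ _ _ _ _
        · have : ff R G (G.src e) w [] = 0 := by simp [ff, pp_nil, vv_ne R G hw]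
          rw [this, mul_zero, zero_mul]; exact zero_mem _
      | cons f t =>
        by_cases hs : G.src e = G.src f
        · rw [hs, ff_cons, ← mul_assoc]
          by_cases hef : e = f
          · subst hef
            rw [gg_ee, vv_ff]; exact MA_mono_mem R G _ _ _ _ _
          · rw [gg_ee_ne R G hef]; simp
        · rw [ff_cons_ne R G w hs]; simp
    · have : gg R G e * ff R G u w a = 0 := by
        simp only [ff, ← mul_assoc, gg_vv_ne R G hz, zero_mul]
      rw [this, zero_mul]; exact zero_mem _

theorem mul_MA {x : Ambient R G} (hx : x ∈ LeavittSubalgebra R G) :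
    ∀ m ∈ MA R G, x * m ∈ MA R G := by
  induction hx using NonUnitalAlgebra.adjoin_induction with
  | mem x hx =>
    obtain ⟨y, rfl⟩ := hx
    intro m hm
    induction hm using Submodule.span_induction with
    | mem m hm => obtain ⟨a, b, u, w, v, rfl⟩ := hm; exact gen_mul R G y a b u w v
    | zero => simp
    | add a b _ _ ha hb => rw [mul_add]; exact add_mem ha hb
    | smul r a _ ha => rw [mul_smul_comm]; exact Submodule.smul_mem _ _ ha
  | add x y _ _ hx hy => intro m hm; rw [add_mul]; exact add_mem (hx m hm) (hy m hm)
  | zero => intro m hm; simp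
  | mul x y _ _ hx hy => intro m hm; rw [mul_assoc]; exact hx _ (hy m hm)
  | smul r x _ hx => intro m hm; rw [smul_mul_assoc]; exact Submodule.smul_mem _ _ (hx m hm)

theorem sum_vv_mul [DecidableEq G.V] {F : Finset G.V} {v : G.V} (h : v ∈ F) :
    (∑ u ∈ F, vv R G u) * vv R G v = vv R G v := by
  rw [Finset.sum_mul, Finset.sum_eq_single v, vv_self]
  · intro b _ hb; exact vv_ne R G hb
  · intro h'; exact absurd h h'

theorem vv_mul_sum [DecidableEq G.V] {F : Finset G.V} {v : G.V} (h : v ∈ F) :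
    vv R G v * (∑ u ∈ F, vv R G u) = vv R G v := by
  rw [Finset.mul_sum, Finset.sum_eq_single v, vv_self]
  · intro b _ hb; exact vv_ne R G (Ne.symm hb)
  · intro h'; exact absurd h h'

theorem local_unit_right {x : Ambient R G} (hx : x ∈ LeavittSubalgebra R G) :
    ∃ F : Finset G.V, x * (∑ u ∈ F, vv R G u) = x := by
  classical
  suffices H : ∃ F : Finset G.V, ∀ F', F ⊆ F' → x * (∑ u ∈ F', vv R G u) = x by
    obtain ⟨F, hF⟩ := H; exact ⟨F, hF F (Finset.Subset.refl _)⟩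
  have key : ∀ (y : Ambient R G) (v : G.V), y * vv R G v = y →
      ∃ F : Finset G.V, ∀ F', F ⊆ F' → y * (∑ u ∈ F', vv R G u) = y := by
    intro y v hy
    refine ⟨{v}, fun F' hF' => ?_⟩
    rw [← hy, mul_assoc, vv_mul_sum R G (hF' (by simp))]
  induction hx using NonUnitalAlgebra.adjoin_induction with
  | mem x hx =>
    obtain ⟨y, rfl⟩ := hx
    cases y with
    | vert v => exact key _ v (vv_self R G v)
    | edge e => exact key _ _ (ee_rng R G e)
    | ghost e => exact key _ _ (gg_src R G e)
  | add x y _ _ hx hy =>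
    obtain ⟨F, hF⟩ := hx
    obtain ⟨F2, hF2⟩ := hy
    refine ⟨F ∪ F2, fun F' h => ?_⟩
    rw [add_mul, hF F' (Finset.union_subset_left h), hF2 F' (Finset.union_subset_right h)]
  | zero => exact ⟨∅, by simp⟩
  | mul x y _ _ hx hy =>
    obtain ⟨F, hF⟩ := hy
    exact ⟨F, fun F' h => by rw [mul_assoc, hF F' h]⟩
  | smul r x _ hx =>
    obtain ⟨F, hF⟩ := hx
    exact ⟨F, fun F' h => by rw [smul_mul_assoc, hF F' h]⟩

theorem mem_MA {x : Ambient R G} (hx : x ∈ LeavittSubalgebra R G) : x ∈ MA R G := by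
  obtain ⟨F, hF⟩ := local_unit_right R G hx
  rw [← hF]
  apply mul_MA R G hx
  apply Submodule.sum_mem
  intro v _
  have := MA_mono_mem R G [] [] v v v
  rwa [ff_nil, hh_nil, vv_self] at this

theorem MA_MM {x : Ambient R G} (hx : x ∈ MA R G) (u v : G.V) :
    ∃ n, vv R G u * x * vv R G v ∈ MM R G n u v := by
  induction hx using Submodule.span_induction with
  | mem m hm =>
    obtain ⟨a, b, u', w, v', rfl⟩ := hm
    refine ⟨b.length, ?_⟩
    by_cases hu : u = u'
    · subst hu
      by_cases hv : v' = v
      · subst hv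
        rw [← mul_assoc, vv_ff, mul_assoc, hh_vv]
        exact Submodule.subset_span ⟨a, b, w, le_rfl, rfl⟩
      · have : hh R G w v' b * vv R G v = 0 := by
          simp only [hh, mul_assoc, vv_ne R G hv, mul_zero]
        rw [mul_assoc, mul_assoc, this]; simp
    · have : vv R G u * ff R G u' w a = 0 := by
        simp only [ff, ← mul_assoc, vv_ne R G hu, zero_mul]
      rw [← mul_assoc, this]; simp
  | zero => exact ⟨0, by simp⟩
  | add a b _ _ ha hb =>
    obtain ⟨n, hn⟩ := ha
    obtain ⟨m, hm⟩ := hb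
    refine ⟨max n m, ?_⟩
    rw [mul_add, add_mul]
    exact add_mem (MM_mono R G (le_max_left _ _) u v hn) (MM_mono R G (le_max_right _ _) u v hm)
  | smul r a _ ha =>
    obtain ⟨n, hn⟩ := ha
    refine ⟨n, ?_⟩
    rw [mul_smul_comm, smul_mul_assoc]
    exact Submodule.smul_mem _ _ hn

theorem MA_eq_zero {x : Ambient R G} (hx : x ∈ MA R G)
    (h : ∀ u v, vv R G u * x * vv R G v = 0) : x = 0 := by
  classical
  have H : ∃ F : Finset G.V, ∀ F', F ⊆ F' →
      (∑ u ∈ F', vv R G u) * x * (∑ u ∈ F', vv R G u) = x := by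
    clear h
    induction hx using Submodule.span_induction with
    | mem m hm =>
      obtain ⟨a, b, u, w, v, rfl⟩ := hm
      refine ⟨{u, v}, fun F' hF => ?_⟩
      rw [← vv_ff, ← hh_vv, ← mul_assoc, ← mul_assoc, ← mul_assoc,
        sum_vv_mul R G (hF (by simp)), mul_assoc _ (vv R G v), vv_mul_sum R G (hF (by simp))]
      simp only [mul_assoc]
    | zero => exact ⟨∅, by simp⟩
    | add a b _ _ ha hb =>
      obtain ⟨F, hF⟩ := ha
      obtain ⟨F2, hF2⟩ := hb
      refine ⟨F ∪ F2, fun F' h => ?_⟩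
      rw [mul_add, add_mul, hF F' (Finset.union_subset_left h),
        hF2 F' (Finset.union_subset_right h)]
    | smul r a _ ha =>
      obtain ⟨F, hF⟩ := ha
      refine ⟨F, fun F' h => ?_⟩
      rw [mul_smul_comm, smul_mul_assoc, hF F' h]
  obtain ⟨F, hF⟩ := H
  rw [← hF F (Finset.Subset.refl _), Finset.sum_mul, Finset.sum_mul]
  apply Finset.sum_eq_zero
  intro u _
  rw [Finset.mul_sum]
  exact Finset.sum_eq_zero fun v _ => h u v

theorem MM_zero {x : Ambient R G} {u v : G.V} (hx : x ∈ MM R G 0 u v) :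
    ∃ c : List G.E →₀ R, (∀ a ∈ c.support, IsPathFrom G u a v) ∧
      x = c.sum fun a r => r • ff R G u v a := by
  have : x ∈ Submodule.span R (ff R G u v '' {a | IsPathFrom G u a v}) := by
    refine Submodule.span_le.2 ?_ hx
    rintro y ⟨a, b, w, hb, rfl⟩
    have : b = [] := List.eq_nil_of_length_eq_zero (by omega)
    subst this
    by_cases hw : w = v
    · subst hw
      rw [hh_nil, ff_vv]
      by_cases hp : IsPathFrom G u a w
      · exact Submodule.subset_span ⟨a, hp, rfl⟩
      · rw [ff_not_path R G hp]; exact zero_mem _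
    · have : hh R G w v [] = 0 := by simp [hh, qq_nil, vv_ne R G hw]
      rw [this, mul_zero]; exact zero_mem _
  rw [Finsupp.mem_span_image_iff_linearCombination] at this
  obtain ⟨c, hc, rfl⟩ := this
  refine ⟨c, fun a ha => hc ha, ?_⟩
  rw [Finsupp.linearCombination_apply]

theorem MM_mul_right {x : Ambient R G} {n : ℕ} {u v : G.V} (hx : x ∈ MM R G n u v) :
    x * vv R G v = x := by
  induction hx using Submodule.span_induction with
  | mem m hm => obtain ⟨a, b, w, _, rfl⟩ := hm; rw [mul_assoc, hh_vv]
  | zero => simp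
  | add a b _ _ ha hb => rw [add_mul, ha, hb]
  | smul r a _ ha => rw [smul_mul_assoc, ha]

theorem MM_zero_mul_ee {x : Ambient R G} {u : G.V} {e : G.E}
    (hx : x ∈ MM R G 0 u (G.src e)) : x * ee R G e ∈ MM R G 0 u (G.rng e) := by
  obtain ⟨c, hc, rfl⟩ := MM_zero R G hx
  rw [Finsupp.sum, Finset.sum_mul]
  apply Submodule.sum_mem
  intro a ha
  rw [smul_mul_assoc]
  apply Submodule.smul_mem
  apply Submodule.subset_span
  refine ⟨a ++ [e], [], G.rng e, le_rfl, ?_⟩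
  rw [hh_nil, ff_vv, ← ff_mul R G (hc a ha), ff_cons, ff_nil, ee_rng]

theorem MM_decomp {x : Ambient R G} {n : ℕ} {u v : G.V} (hx : x ∈ MM R G (n + 1) u v) :
    ∃ p ∈ MM R G 0 u v, ∃ y : G.E →₀ Ambient R G,
      (∀ e, y e ∈ MM R G n u (G.rng e)) ∧ (∀ e, G.src e ≠ v → y e = 0) ∧
      x = p + y.sum fun e a => a * gg R G e := by
  classical
  induction hx using Submodule.span_induction with
  | mem m hm =>
    obtain ⟨a, b, w, hb, rfl⟩ := hm
    cases b with
    | nil =>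
      exact ⟨_, Submodule.subset_span ⟨a, [], w, le_rfl, rfl⟩, 0, by simp, by simp, by simp⟩
    | cons e t =>
      by_cases he : G.src e = v
      · subst he
        refine ⟨0, zero_mem _, Finsupp.single e (ff R G u w a * hh R G w (G.rng e) t), ?_, ?_, ?_⟩
        · intro e'
          by_cases h : e = e'
          · subst h
            rw [Finsupp.single_eq_same]
            exact Submodule.subset_span ⟨a, t, w, by simpa using hb, rfl⟩
          · rw [Finsupp.single_apply, if_neg h]; exact zero_mem _
        · intro e' h
          rw [Finsupp.single_apply, if_neg]
          rintro rfl; exact h rfl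
        · rw [Finsupp.sum_single_index (by simp), hh_cons, zero_add, mul_assoc]
      · exact ⟨0, zero_mem _, 0, by simp, by simp, by simp [hh_cons_ne R G w he]⟩
  | zero => exact ⟨0, zero_mem _, 0, by simp, by simp, by simp⟩
  | add a b _ _ ha hb =>
    obtain ⟨p, hp, y, hy, hy0, rfl⟩ := ha
    obtain ⟨p', hp', y', hy', hy0', rfl⟩ := hb
    refine ⟨p + p', add_mem hp hp', y + y', fun e => add_mem (hy e) (hy' e), ?_, ?_⟩
    · intro e he; simp [hy0 e he, hy0' e he]
    · rw [Finsupp.sum_add_index' (by simp) (by intros; rw [add_mul])]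
      abel
  | smul r a _ ha =>
    obtain ⟨p, hp, y, hy, hy0, rfl⟩ := ha
    refine ⟨r • p, Submodule.smul_mem _ _ hp, r • y, fun e => Submodule.smul_mem _ _ (hy e), ?_, ?_⟩
    · intro e he; simp [hy0 e he]
    · rw [Finsupp.sum_smul_index' (by simp), smul_add, Finsupp.smul_sum]
      simp only [smul_mul_assoc]

variable {R G}

theorem strong_real (hL : G.CondL) (K : Ambient R G → Prop)
    (hKl : ∀ a x, a ∈ LeavittSubalgebra R G → K x → K (a * x))
    (hKr : ∀ a x, a ∈ LeavittSubalgebra R G → K x → K (x * a))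
    (hKv : ∀ v (r : R), K (r • vv R G v) → r = 0)
    {u v : G.V} (c : List G.E →₀ R) (hc : ∀ a ∈ c.support, IsPathFrom G u a v)
    (hK : K (c.sum fun a r => r • ff R G u v a)) : c = 0 := by
  classical
  by_contra hne
  obtain ⟨α, hα, hmin⟩ := Finset.exists_min_image c.support List.length
    (Finsupp.support_nonempty_iff.2 hne)
  have hαp := hc α hα
  obtain ⟨m, w, hm, hT⟩ := exists_mu hL v (c.support.image (List.drop α.length))
  have h1 := hKr _ _ (ff_mem R G v w m) (hKl _ _ (hh_mem R G w v m)
    (hKl _ _ (hh_mem R G v u α) hK))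
  have h2 : hh R G w v m * (hh R G v u α * c.sum fun a r => r • ff R G u v a) * ff R G v w m
      = c α • vv R G w := by
    rw [Finsupp.sum, Finset.mul_sum, Finset.mul_sum, Finset.sum_mul, Finset.sum_eq_single α]
    · have h3 := hh_ff_prefix R G (v := v) (b := []) hαp
      have h4 := hh_ff_prefix R G (v := w) (b := []) hm
      rw [List.append_nil] at h3 h4
      rw [mul_smul_comm, mul_smul_comm, smul_mul_assoc, h3, ff_nil, hh_vv, h4, ff_nil]
    · intro β hβ hβα
      rw [mul_smul_comm, mul_smul_comm, smul_mul_assoc]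
      by_cases hpre : α <+: β
      · obtain ⟨g, rfl⟩ := hpre
        have hgp : IsPathFrom G v g v := path_append_right hαp (hc _ hβ)
        have hg0 : g ≠ [] := by rintro rfl; simp at hβα
        have hnp := hT g (Finset.mem_image.2 ⟨_, hβ, by simp⟩) hg0 hgp
        rw [hh_ff_prefix R G hαp, mul_assoc, ff_mul R G hgp, hh_ff_not R G hm (by simp) hnp,
          smul_zero]
      · rw [hh_ff_not R G hαp (hmin β hβ) hpre, mul_zero, zero_mul, smul_zero]
    · intro h; exact absurd hα h
  rw [h2] at h1
  exact (Finsupp.mem_support_iff.1 hα) (hKv _ _ h1)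

theorem MM_inj (hL : G.CondL) (K : Ambient R G → Prop)
    (hKl : ∀ a x, a ∈ LeavittSubalgebra R G → K x → K (a * x))
    (hKr : ∀ a x, a ∈ LeavittSubalgebra R G → K x → K (x * a))
    (hKv : ∀ v (r : R), K (r • vv R G v) → r = 0) (n : ℕ) :
    ∀ (u v : G.V), ∀ x ∈ MM R G n u v, K x → x = 0 := by
  have base : ∀ (u v : G.V), ∀ x ∈ MM R G 0 u v, K x → x = 0 := by
    intro u v x hx hK
    obtain ⟨c, hc, rfl⟩ := MM_zero R G hx
    rw [strong_real hL K hKl hKr hKv c hc hK, Finsupp.sum_zero_index]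
  induction n with
  | zero => exact base
  | succ n ih =>
    intro u v x hx hK
    obtain ⟨p, hp, y, hy, hy0, hxe⟩ := MM_decomp R G hx
    have hmul : ∀ e, G.src e = v → x * ee R G e = p * ee R G e + y e := by
      intro e he
      rw [hxe, add_mul, Finsupp.sum, Finset.sum_mul]
      congr 1
      rw [Finset.sum_eq_single e, mul_assoc, gg_ee, MM_mul_right R G (hy e)]
      · intro f _ hf; rw [mul_assoc, gg_ee_ne R G hf, mul_zero]
      · intro h; rw [Finsupp.notMem_support_iff.1 h]; simp
    have hxe0 : ∀ e, G.src e = v → x * ee R G e = 0 := by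
      intro e he
      apply ih u (G.rng e)
      · rw [hmul e he]
        subst he
        exact add_mem (MM_mono R G (Nat.zero_le _) _ _ (MM_zero_mul_ee R G hp)) (hy e)
      · exact hKr _ _ (ugen_mem R G _) hK
    by_cases hfin : {e : G.E | G.src e = v}.Finite
    · by_cases hne : {e : G.E | G.src e = v}.Nonempty
      · have hck := vv_ck R G v hfin.toFinset (by simp) (by simpa using hne)
        rw [← MM_mul_right R G hx, hck, Finset.mul_sum]
        apply Finset.sum_eq_zero
        intro e he
        rw [← mul_assoc, hxe0 e (by simpa using he), zero_mul]
      · have hy' : y = 0 := by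
          ext1 e
          exact hy0 e (fun h => hne ⟨e, h⟩)
        rw [hy', Finsupp.sum_zero_index, add_zero] at hxe
        exact base u v x (hxe ▸ hp) hK
    · obtain ⟨e, he, hey⟩ := Set.Infinite.exists_notMem_finset hfin y.support
      have he : G.src e = v := he
      have hye : y e = 0 := Finsupp.notMem_support_iff.1 hey
      have hpe : K (p * ee R G e) := by
        have := hmul e he
        rw [hye, add_zero] at this
        rw [← this]
        exact hKr _ _ (ugen_mem R G _) hK
      have hp0 : p = 0 := by
        obtain ⟨c, hc, rfl⟩ := MM_zero R G hp
        have hinj : Function.Injective (fun a : List G.E => a ++ [e]) :=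
          fun a b h => List.append_cancel_right h
        have : c.mapDomain (fun a => a ++ [e]) = 0 := by
          classical
          apply strong_real hL K hKl hKr hKv (u := u) (v := G.rng e)
          · intro a ha
            obtain ⟨b, hb, rfl⟩ := Finset.mem_image.1 (Finsupp.mapDomain_support ha)
            exact path_append (hc b hb) (IsPathFrom.cons e he (IsPathFrom.nil _))
          · rw [Finsupp.sum_mapDomain_index (by simp) (by intros; rw [add_smul])]
            convert hpe using 1
            rw [Finsupp.sum, Finsupp.sum, Finset.sum_mul]
            apply Finset.sum_congr rfl
            intro a ha
            subst he
            rw [smul_mul_assoc, ← ff_mul R G (hc a ha), ff_cons, ff_nil, ee_rng]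
        have hc0 : c = 0 := Finsupp.mapDomain_injective hinj (by rw [this, Finsupp.mapDomain_zero])
        rw [hc0, Finsupp.sum_zero_index]
      have hy' : y = 0 := by
        ext1 f
        by_cases hf : G.src f = v
        · have := hmul f hf
          rw [hxe0 f hf, hp0, zero_mul, zero_add] at this
          exact this.symm
        · exact hy0 f hf
      rw [hxe, hp0, hy', Finsupp.sum_zero_index, add_zero]

end Alg
end CK
end LPAGraph

open LPAGraph in
/-- **Cuntz-Krieger Uniqueness Theorem.**  Let `E` be a graph satisfying Condition (L) and
let `R` be a commutative ring with unit.  If `S` is a ring and `φ : L_R(E) → S` is a ring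
homomorphism with `φ(r • v) ≠ 0` for every vertex `v ∈ E⁰` and every `r ∈ R \ {0}`, then
`φ` is injective. -/
theorem stmt10 (R : Type) [CommRing R] (G : LPAGraph) (hL : G.CondL)
    (S : Type) [NonUnitalRing S] (phi : LeavittPathAlgebra R G →ₙ+* S)
    (hvert : ∀ (v : G.V) (r : R), r ≠ 0 → phi (r • vertexElem R G v) ≠ 0) :
    Function.Injective phi := by
  have key : ∀ z : LeavittPathAlgebra R G, phi z = 0 → z = 0 := by
    intro z hz
    have hzA := CK.mem_MA R G z.2
    let K : Ambient R G → Prop := fun x => ∃ h : x ∈ LeavittSubalgebra R G, phi ⟨x, h⟩ = 0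
    have hKl : ∀ a x, a ∈ LeavittSubalgebra R G → K x → K (a * x) := by
      rintro a x ha ⟨hx, h0⟩
      refine ⟨mul_mem ha hx, ?_⟩
      have := map_mul phi ⟨a, ha⟩ ⟨x, hx⟩
      rw [h0, mul_zero] at this
      exact this
    have hKr : ∀ a x, a ∈ LeavittSubalgebra R G → K x → K (x * a) := by
      rintro a x ha ⟨hx, h0⟩
      refine ⟨mul_mem hx ha, ?_⟩
      have := map_mul phi ⟨x, hx⟩ ⟨a, ha⟩
      rw [h0, zero_mul] at this
      exact this
    have hKv : ∀ v (r : R), K (r • CK.vv R G v) → r = 0 := by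
      rintro v r ⟨hx, h0⟩
      by_contra hr
      exact hvert v r hr h0
    apply Subtype.ext
    apply CK.MA_eq_zero R G hzA
    intro u v
    obtain ⟨n, hn⟩ := CK.MA_MM R G hzA u v
    exact CK.MM_inj hL K hKl hKr hKv n u v _ hn
      (hKr _ _ (ugen_mem R G _) (hKl _ _ (ugen_mem R G _) ⟨z.2, hz⟩))
  intro x y hxy
  exact sub_eq_zero.1 (key _ (by rw [map_sub, hxy, sub_self]))
end
end

section
/- Let E be a graph and R a commutative ring with unit. If I is an ideal of L_R(E), then the set H_I := { v ∈ E⁰ : v ∈ I } is a saturated hereditary subset of E⁰. -/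
set_option maxHeartbeats 1000000
set_option synthInstance.maxHeartbeats 400000

noncomputable section

open LPAGraph in
/-- **Lemma.**  If `I` is an ideal of `L_R(E)`, then `H_I = {v ∈ E⁰ : v ∈ I}` is a
saturated hereditary subset of `E⁰`. -/
theorem stmt11 (R : Type) [CommRing R] (G : LPAGraph)
    (I : TwoSidedIdeal (LeavittPathAlgebra R G)) :
    G.Hereditary {v : G.V | vertexElem R G v ∈ I} ∧
    G.Saturated {v : G.V | vertexElem R G v ∈ I} := by
  have key : ∀ {a b : FreeAlgebra R (LGen G)}, LeavittRel R G a b →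
      RingQuot.mkAlgHom R (LeavittRel R G) a = RingQuot.mkAlgHom R (LeavittRel R G) b :=
    fun h => RingQuot.mkAlgHom_rel R h
  have h1 : ∀ e, vertexElem R G (G.rng e)
      = ghostElem R G e * vertexElem R G (G.src e) * edgeElem R G e := by
    intro e
    apply Subtype.ext
    have a := key (LeavittRel.ghost_mul_src e)
    have b := key (LeavittRel.ghost_mul_self e)
    rw [map_mul] at a b
    change ugen R G _ = ugen R G _ * ugen R G _ * ugen R G _
    unfold ugen
    rw [a, b]
  have h2 : ∀ e, edgeElem R G e * vertexElem R G (G.rng e) = edgeElem R G e := by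
    intro e
    apply Subtype.ext
    have a := key (LeavittRel.edge_mul_rng e)
    rw [map_mul] at a
    exact a
  refine ⟨?_, ?_⟩
  · intro e he
    change vertexElem R G (G.rng e) ∈ I
    rw [h1]
    exact I.mul_mem_right _ _ (I.mul_mem_left _ _ he)
  · intro v hv hr
    obtain ⟨hfin, hne⟩ := hv
    have h3 : vertexElem R G v
        = ∑ e ∈ hfin.toFinset, edgeElem R G e * ghostElem R G e := by
      apply Subtype.ext
      have a := key (LeavittRel.ck v hfin.toFinset (by simp) (by simpa using hne))
      rw [map_sum] at a
      simp only [map_mul] at a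
      rw [AddSubmonoidClass.coe_finsetSum]
      exact a
    change vertexElem R G v ∈ I
    rw [h3]
    refine sum_mem fun e he => ?_
    rw [← h2 e]
    exact I.mul_mem_right _ _ (I.mul_mem_left _ _ (hr e (by simpa using he)))
end
end

section
/- Let E be a graph and R a commutative ring with unit. If X is a hereditary subset of E⁰ and I_X is the two-sided ideal of L_R(E) generated by {v : v ∈ X}, then I_X = I_{X̄}, where X̄ denotes the saturation of X (the smallest saturated hereditary subset of E⁰ containing X). In particular, I_X is a graded basic ideal that is also an idempotent ring. -/
set_option maxHeartbeats 1000000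
set_option synthInstance.maxHeartbeats 400000

noncomputable section

namespace LPAGraph

section rels
variable (R : Type) [CommRing R] (G : LPAGraph)

theorem r_vv (v : G.V) : ugen R G (.vert v) * ugen R G (.vert v) = ugen R G (.vert v) := by
  have := RingQuot.mkAlgHom_rel R (LeavittRel.vert_mul_self (R := R) v)
  simpa [ugen] using this

theorem r_vw (v w : G.V) (h : v ≠ w) : ugen R G (.vert v) * ugen R G (.vert w) = 0 := by
  have := RingQuot.mkAlgHom_rel R (LeavittRel.vert_mul_vert (R := R) v w h)
  simpa [ugen] using this

theorem r_se (e : G.E) :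
    ugen R G (.vert (G.src e)) * ugen R G (.edge e) = ugen R G (.edge e) := by
  have := RingQuot.mkAlgHom_rel R (LeavittRel.src_mul_edge (R := R) e)
  simpa [ugen] using this

theorem r_er (e : G.E) :
    ugen R G (.edge e) * ugen R G (.vert (G.rng e)) = ugen R G (.edge e) := by
  have := RingQuot.mkAlgHom_rel R (LeavittRel.edge_mul_rng (R := R) e)
  simpa [ugen] using this

theorem r_rg (e : G.E) :
    ugen R G (.vert (G.rng e)) * ugen R G (.ghost e) = ugen R G (.ghost e) := by
  have := RingQuot.mkAlgHom_rel R (LeavittRel.rng_mul_ghost (R := R) e)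
  simpa [ugen] using this

theorem r_gs (e : G.E) :
    ugen R G (.ghost e) * ugen R G (.vert (G.src e)) = ugen R G (.ghost e) := by
  have := RingQuot.mkAlgHom_rel R (LeavittRel.ghost_mul_src (R := R) e)
  simpa [ugen] using this

theorem r_ge (e : G.E) :
    ugen R G (.ghost e) * ugen R G (.edge e) = ugen R G (.vert (G.rng e)) := by
  have := RingQuot.mkAlgHom_rel R (LeavittRel.ghost_mul_self (R := R) e)
  simpa [ugen] using this

theorem r_gf (e f : G.E) (h : e ≠ f) :
    ugen R G (.ghost e) * ugen R G (.edge f) = 0 := by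
  have := RingQuot.mkAlgHom_rel R (LeavittRel.ghost_mul_edge (R := R) e f h)
  simpa [ugen] using this

theorem r_ck (v : G.V) (s : Finset G.E) (hs : ∀ e : G.E, e ∈ s ↔ G.src e = v)
    (hne : s.Nonempty) :
    ugen R G (.vert v) = ∑ e ∈ s, ugen R G (.edge e) * ugen R G (.ghost e) := by
  have := RingQuot.mkAlgHom_rel R (LeavittRel.ck (R := R) v s hs hne)
  simpa [ugen] using this

variable {G}

theorem uPath_cons {u : G.V} (e : G.E) (es : List G.E) (h : G.src e = u) :
    uPath R G u (e :: es) = ugen R G (.edge e) * uPath R G (G.rng e) es := by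
  subst h
  simp only [uPath, List.map_cons, List.prod_cons, ← mul_assoc, r_se, r_er]

theorem uGhostPath_cons {u : G.V} (e : G.E) (es : List G.E) (h : G.src e = u) :
    uGhostPath R G u (e :: es) = uGhostPath R G (G.rng e) es * ugen R G (.ghost e) := by
  subst h
  simp only [uGhostPath, List.map_cons, List.reverse_cons, List.prod_append, List.prod_cons,
    List.prod_nil, mul_one, mul_assoc, r_gs, r_rg]

theorem vert_mul_uPath (u : G.V) (es : List G.E) :
    ugen R G (.vert u) * uPath R G u es = uPath R G u es := by
  simp only [uPath, ← mul_assoc, r_vv]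

theorem uGhostPath_mul_vert (u : G.V) (es : List G.E) :
    uGhostPath R G u es * ugen R G (.vert u) = uGhostPath R G u es := by
  simp only [uGhostPath, mul_assoc, r_vv]

theorem uPath_mul_vert {u w : G.V} {es : List G.E} (h : IsPathFrom G u es w) :
    uPath R G u es * ugen R G (.vert w) = uPath R G u es := by
  induction h with
  | nil v => simp [uPath, r_vv]
  | cons e h ht ih => rw [uPath_cons R e _ h, mul_assoc, ih]

theorem vert_mul_uGhostPath {u w : G.V} {es : List G.E} (h : IsPathFrom G u es w) :
    ugen R G (.vert w) * uGhostPath R G u es = uGhostPath R G u es := by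
  induction h with
  | nil v => simp [uGhostPath, r_vv]
  | cons e h ht ih => rw [uGhostPath_cons R e _ h, ← mul_assoc, ih]

theorem isPath_snoc {u w : G.V} {es : List G.E} (h : IsPathFrom G u es w) (e : G.E)
    (he : G.src e = w) : IsPathFrom G u (es ++ [e]) (G.rng e) := by
  induction h with
  | nil v => exact .cons e he (.nil _)
  | cons f h ht ih => exact .cons f h (ih he)

theorem uPath_snoc (u : G.V) (es : List G.E) (e : G.E) :
    uPath R G u (es ++ [e]) = uPath R G u es * ugen R G (.edge e) := by
  simp [uPath, mul_assoc]

theorem uGhostPath_snoc (u : G.V) (es : List G.E) (e : G.E) :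
    uGhostPath R G u (es ++ [e]) = ugen R G (.ghost e) * uGhostPath R G u es := by
  simp [uGhostPath, mul_assoc]

/-- monomials through `X` -/
def monX (X : Set G.V) : Set (Ambient R G) :=
  {x | ∃ (u : G.V) (es : List G.E) (u' : G.V) (es' : List G.E) (w : G.V),
    IsPathFrom G u es w ∧ IsPathFrom G u' es' w ∧ w ∈ X ∧
    x = uPath R G u es * uGhostPath R G u' es'}

theorem gen_mul_mon {X : Set G.V} (hX : G.Hereditary X) (g : LGen G) {x : Ambient R G}
    (hx : x ∈ monX R X) : ugen R G g * x = 0 ∨ ugen R G g * x ∈ monX R X := by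
  obtain ⟨u, es, u', es', w, h, h', hw, rfl⟩ := hx
  rw [← mul_assoc]
  cases g with
  | vert v =>
    by_cases hv : v = u
    · subst hv
      right
      rw [vert_mul_uPath]
      exact ⟨v, es, u', es', w, h, h', hw, rfl⟩
    · left
      rw [← vert_mul_uPath, ← mul_assoc, r_vw R G v u hv]; simp
  | edge e =>
    by_cases hv : G.rng e = u
    · subst hv
      right
      rw [← uPath_cons R e es rfl]
      exact ⟨_, _, u', es', w, .cons e rfl h, h', hw, rfl⟩
    · left
      rw [← vert_mul_uPath, ← r_er, ← mul_assoc, mul_assoc (ugen R G (.edge e)),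
        r_vw R G _ u hv]; simp
  | ghost e =>
    cases h with
    | nil =>
      by_cases hv : G.src e = u
      · subst hv
        right
        refine ⟨_, [], u', es' ++ [e], G.rng e, .nil _, isPath_snoc h' e rfl, hX e hw, ?_⟩
        simp only [uPath, uGhostPath_snoc, List.map_nil, List.prod_nil, mul_one]
        rw [r_gs, ← mul_assoc, r_rg]
      · left
        rw [← vert_mul_uPath, ← r_gs, ← mul_assoc, mul_assoc (ugen R G (.ghost e)),
          r_vw R G _ u hv]; simp
    | cons f hf ht =>
      rw [uPath_cons R f _ hf, ← mul_assoc]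
      by_cases hv : e = f
      · subst hv
        right
        rw [r_ge, vert_mul_uPath]
        exact ⟨_, _, u', es', w, ht, h', hw, rfl⟩
      · left
        rw [r_gf R G e f hv]; simp

theorem mon_mul_gen {X : Set G.V} (hX : G.Hereditary X) (g : LGen G) {x : Ambient R G}
    (hx : x ∈ monX R X) : x * ugen R G g = 0 ∨ x * ugen R G g ∈ monX R X := by
  obtain ⟨u, es, u', es', w, h, h', hw, rfl⟩ := hx
  rw [mul_assoc]
  cases g with
  | vert v =>
    by_cases hv : u' = v
    · subst hv
      right
      rw [uGhostPath_mul_vert]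
      exact ⟨_, es, _, es', w, h, h', hw, rfl⟩
    · left
      rw [← uGhostPath_mul_vert, mul_assoc (uGhostPath R G u' es'), r_vw R G _ _ hv]; simp
  | ghost e =>
    by_cases hv : u' = G.rng e
    · subst hv
      right
      rw [← uGhostPath_cons R e es' rfl]
      exact ⟨_, _, _, _, w, h, .cons e rfl h', hw, rfl⟩
    · left
      rw [← uGhostPath_mul_vert, ← r_rg, mul_assoc (uGhostPath R G u' es'),
        ← mul_assoc (ugen R G (.vert u')), r_vw R G _ _ hv]; simp
  | edge e =>
    cases h' with
    | nil =>
      by_cases hv : u' = G.src e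
      · subst hv
        right
        refine ⟨_, es ++ [e], _, [], G.rng e, isPath_snoc h e rfl, .nil _, hX e hw, ?_⟩
        simp only [uGhostPath, uPath_snoc, List.map_nil, List.reverse_nil, List.prod_nil, one_mul]
        rw [r_se, mul_assoc, r_er]
      · left
        rw [← uGhostPath_mul_vert, ← r_se, mul_assoc (uGhostPath R G u' []),
          ← mul_assoc (ugen R G (.vert u')), r_vw R G _ _ hv]; simp
    | cons f hf ht =>
      rw [uGhostPath_cons R f _ hf, mul_assoc (uGhostPath R G (G.rng f) _)]
      by_cases hv : f = e
      · subst hv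
        right
        rw [r_ge, uGhostPath_mul_vert]
        exact ⟨_, _, _, _, w, h, ht, hw, rfl⟩
      · left
        rw [r_gf R G _ _ hv]; simp

theorem gen_mul_span {X : Set G.V} (hX : G.Hereditary X) (g : LGen G) {x : Ambient R G}
    (hx : x ∈ Submodule.span R (monX R X)) :
    ugen R G g * x ∈ Submodule.span R (monX R X) := by
  induction hx using Submodule.span_induction with
  | mem x hx =>
    rcases gen_mul_mon R hX g hx with h | h
    · rw [h]; exact zero_mem _
    · exact Submodule.subset_span h
  | zero => simp
  | add x y _ _ hx hy => rw [mul_add]; exact add_mem hx hy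
  | smul r x _ hx => rw [mul_smul_comm]; exact Submodule.smul_mem _ _ hx

theorem span_mul_gen {X : Set G.V} (hX : G.Hereditary X) (g : LGen G) {x : Ambient R G}
    (hx : x ∈ Submodule.span R (monX R X)) :
    x * ugen R G g ∈ Submodule.span R (monX R X) := by
  induction hx using Submodule.span_induction with
  | mem x hx =>
    rcases mon_mul_gen R hX g hx with h | h
    · rw [h]; exact zero_mem _
    · exact Submodule.subset_span h
  | zero => simp
  | add x y _ _ hx hy => rw [add_mul]; exact add_mem hx hy
  | smul r x _ hx => rw [smul_mul_assoc]; exact Submodule.smul_mem _ _ hx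

theorem alg_mul_span {X : Set G.V} (hX : G.Hereditary X) {a : Ambient R G}
    (ha : a ∈ LeavittSubalgebra R G) :
    ∀ x ∈ Submodule.span R (monX R X), a * x ∈ Submodule.span R (monX R X) ∧
      x * a ∈ Submodule.span R (monX R X) := by
  unfold LeavittSubalgebra at ha
  induction ha using NonUnitalAlgebra.adjoin_induction with
  | mem a ha =>
    obtain ⟨g, rfl⟩ := ha
    exact fun x hx => ⟨gen_mul_span R hX g hx, span_mul_gen R hX g hx⟩
  | add a b _ _ ha hb =>
    intro x hx
    rw [add_mul, mul_add]
    exact ⟨add_mem (ha x hx).1 (hb x hx).1, add_mem (ha x hx).2 (hb x hx).2⟩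
  | zero => simp
  | mul a b _ _ ha hb =>
    intro x hx
    rw [mul_assoc, ← mul_assoc x]
    exact ⟨(ha _ (hb x hx).1).1, (hb _ (ha x hx).2).2⟩
  | smul r a _ ha =>
    intro x hx
    rw [smul_mul_assoc, mul_smul_comm]
    exact ⟨Submodule.smul_mem _ _ (ha x hx).1, Submodule.smul_mem _ _ (ha x hx).2⟩

theorem ideal_le_span {X : Set G.V} (hX : G.Hereditary X) (x : LeavittPathAlgebra R G)
    (hx : x ∈ idealOfSet R G X) : (x : Ambient R G) ∈ Submodule.span R (monX R X) := by
  let J : TwoSidedIdeal (LeavittPathAlgebra R G) :=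
    TwoSidedIdeal.mk' {x | (x : Ambient R G) ∈ Submodule.span R (monX R X)}
      (by simp) (fun hx hy => by simpa using add_mem hx hy)
      (fun hx => by simpa using hx)
      (fun {x y} hy => (alg_mul_span R hX x.2 _ hy).1)
      (fun {x y} hy => (alg_mul_span R hX y.2 _ hy).2)
  have hJ : ∀ y, y ∈ J ↔ (y : Ambient R G) ∈ Submodule.span R (monX R X) := fun y =>
    TwoSidedIdeal.mem_mk' _ _ _ _ _ _ _
  have : idealOfSet R G X ≤ J := by
    refine TwoSidedIdeal.span_le.2 ?_
    rintro _ ⟨v, hv, rfl⟩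
    refine (hJ _).2 (Submodule.subset_span ⟨v, [], v, [], v, .nil _, .nil _, hv, ?_⟩)
    simp [uPath, uGhostPath, vertexElem, r_vv]
  exact (hJ x).1 (this hx)

theorem vert_mem_ideal {X : Set G.V} {v : G.V} (hv : v ∈ X) :
    vertexElem R G v ∈ idealOfSet R G X :=
  TwoSidedIdeal.subset_span ⟨v, hv, rfl⟩

theorem path_mem_ideal {X : Set G.V} {u w : G.V} {es : List G.E} (h : IsPathFrom G u es w)
    (hw : w ∈ X) : pathElem R G u es ∈ idealOfSet R G X := by
  have : pathElem R G u es = pathElem R G u es * vertexElem R G w :=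
    Subtype.ext (uPath_mul_vert R h).symm
  rw [this]
  exact TwoSidedIdeal.mul_mem_left _ _ _ (vert_mem_ideal R hw)

theorem ghost_mem_ideal {X : Set G.V} {u w : G.V} {es : List G.E} (h : IsPathFrom G u es w)
    (hw : w ∈ X) : ghostPathElem R G u es ∈ idealOfSet R G X := by
  have : ghostPathElem R G u es = vertexElem R G w * ghostPathElem R G u es :=
    Subtype.ext (vert_mul_uGhostPath R h).symm
  rw [this]
  exact TwoSidedIdeal.mul_mem_right _ _ _ (vert_mem_ideal R hw)

theorem ideal_decomp {X : Set G.V} (hX : G.Hereditary X) (x : LeavittPathAlgebra R G)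
    (hx : x ∈ idealOfSet R G X) :
    ∃ (n : ℕ) (a b : Fin n → LeavittPathAlgebra R G),
      (∀ i, a i ∈ idealOfSet R G X ∧ b i ∈ idealOfSet R G X ∧
        ∃ k : ℤ, a i * b i ∈ component R G k) ∧ x = ∑ i, a i * b i := by
  obtain ⟨n, f, g, h⟩ := Submodule.mem_span_set'.1 (ideal_le_span R hX x hx)
  choose u es u' es' w h1 h2 h3 h4 using fun i => (g i).2
  refine ⟨n, fun i => pathElem R G (u i) (es i), fun i => f i • ghostPathElem R G (u' i) (es' i),
    fun i => ⟨path_mem_ideal R (h1 i) (h3 i), ?_, (es i).length - (es' i).length, ?_⟩, ?_⟩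
  · have : f i • ghostPathElem R G (u' i) (es' i) =
        (f i • vertexElem R G (w i)) * ghostPathElem R G (u' i) (es' i) := by
      rw [smul_mul_assoc]
      congr 1
      exact Subtype.ext (vert_mul_uGhostPath R (h2 i)).symm
    change f i • ghostPathElem R G (u' i) (es' i) ∈ idealOfSet R G X
    rw [this]
    exact TwoSidedIdeal.mul_mem_left _ _ _ (ghost_mem_ideal R (h2 i) (h3 i))
  · rw [mul_smul_comm]
    exact Submodule.smul_mem _ _ (Submodule.subset_span
      ⟨_, _, _, _, w i, h1 i, h2 i, rfl, rfl⟩)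
  · apply Subtype.ext
    rw [← h]
    simp only [AddSubmonoidClass.coe_finsetSum]
    refine Finset.sum_congr rfl fun i _ => ?_
    rw [mul_smul_comm, h4 i]
    rfl

theorem ideal_sat (X : Set G.V) :
    idealOfSet R G X = idealOfSet R G (G.saturation X) := by
  apply le_antisymm
  · refine TwoSidedIdeal.span_le.2 ?_
    rintro _ ⟨v, hv, rfl⟩
    exact vert_mem_ideal R (Set.mem_sInter.2 fun H hH => hH.2.2 hv)
  · refine TwoSidedIdeal.span_le.2 ?_
    rintro _ ⟨v, hv, rfl⟩
    refine Set.mem_sInter.1 hv {v | vertexElem R G v ∈ idealOfSet R G X} ⟨?_, ?_, ?_⟩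
    · intro e he
      have : vertexElem R G (G.rng e) =
          ghostElem R G e * (vertexElem R G (G.src e) * edgeElem R G e) := by
        apply Subtype.ext
        change _ = ugen R G _ * (ugen R G _ * ugen R G _)
        rw [r_se, r_ge]; rfl
      change vertexElem R G (G.rng e) ∈ idealOfSet R G X
      rw [this]
      exact TwoSidedIdeal.mul_mem_left _ _ _ (TwoSidedIdeal.mul_mem_right _ _ _ he)
    · intro v hreg he
      have : vertexElem R G v = ∑ e ∈ hreg.1.toFinset,
          edgeElem R G e * (vertexElem R G (G.rng e) * ghostElem R G e) := by
        apply Subtype.ext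
        rw [AddSubmonoidClass.coe_finsetSum]
        change ugen R G _ = _
        rw [r_ck R G v hreg.1.toFinset (by simp) (by simpa using hreg.2)]
        refine Finset.sum_congr rfl fun e _ => ?_
        change _ = ugen R G _ * (ugen R G _ * ugen R G _)
        rw [r_rg]
      change vertexElem R G v ∈ idealOfSet R G X
      rw [this]
      refine sum_mem fun e hes => ?_
      refine TwoSidedIdeal.mul_mem_left _ _ _ (TwoSidedIdeal.mul_mem_right _ _ _ ?_)
      exact he e (by simpa using hes)
    · exact fun v hv => vert_mem_ideal R hv

/-! Representation -/

theorem exists_shift (G : LPAGraph) (H : Set G.V) :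
    ∃ (T : G.V → ℕ → Option (G.E × ℕ)) (p : G.E → ℕ → ℕ),
      (∀ v m e n, T v m = some (e, n) ↔ (G.rng e ∉ H ∧ G.src e = v ∧ p e n = m)) ∧
      (∀ v m, (∃ e, G.src e = v ∧ G.rng e ∉ H) → T v m ≠ none) := by
  classical
  have := G.countE
  have key : ∀ v : G.V, Nonempty {e : G.E // G.src e = v ∧ G.rng e ∉ H} →
      Nonempty (({e : G.E // G.src e = v ∧ G.rng e ∉ H} × ℕ) ≃ ℕ) := fun v h =>
    nonempty_equiv_of_countable
  have φ := fun v h => Classical.choice (key v h)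
  refine ⟨fun v m => if h : Nonempty {e : G.E // G.src e = v ∧ G.rng e ∉ H} then
      some (((φ v h).symm m).1.1, ((φ v h).symm m).2) else none,
    fun e n => if h : G.rng e ∉ H then φ (G.src e) ⟨e, rfl, h⟩ (⟨e, rfl, h⟩, n) else 0, ?_, ?_⟩
  · intro v m e n
    constructor
    · intro h
      beta_reduce at h
      split_ifs at h with h1
      obtain ⟨⟨⟨e', he1, he2⟩, n'⟩, rfl⟩ := (φ v h1).surjective m
      simp at h
      obtain ⟨rfl, rfl⟩ := h
      subst he1
      simp [he2]
    · rintro ⟨h1, rfl, rfl⟩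
      have : Nonempty {e' : G.E // G.src e' = G.src e ∧ G.rng e' ∉ H} := ⟨e, rfl, h1⟩
      simp [this, h1]
  · rintro v m ⟨e, he⟩
    have : Nonempty {e : G.E // G.src e = v ∧ G.rng e ∉ H} := ⟨e, he⟩
    simp only [this, dite_true]
    simp

open Classical in
/-- action of generators -/
def act (H : Set G.V) (T : G.V → ℕ → Option (G.E × ℕ)) (p : G.E → ℕ → ℕ) :
    LGen G → Module.End R (G.V → ℕ → R)
  | .vert v =>
    { toFun := fun f w n => if w = v ∧ v ∉ H then f w n else 0
      map_add' := by intro f g; ext w n; simp only [Pi.add_apply]; split_ifs <;> simp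
      map_smul' := by intro r f; ext w n; simp }
  | .edge e =>
    { toFun := fun f w m => if T w m = some (e, ((T w m).getD (e, 0)).2) then
        f (G.rng e) ((T w m).getD (e, 0)).2 else 0
      map_add' := by intro f g; ext w n; simp only [Pi.add_apply]; split_ifs <;> simp
      map_smul' := by intro r f; ext w n; simp }
  | .ghost e =>
    { toFun := fun f w n => if w = G.rng e ∧ G.rng e ∉ H then f (G.src e) (p e n) else 0
      map_add' := by intro f g; ext w n; simp only [Pi.add_apply]; split_ifs <;> simp
      map_smul' := by intro r f; ext w n; simp }

theorem act_vert (H : Set G.V) (T p) (v : G.V) (f w n) [Decidable (w = v ∧ v ∉ H)] :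
    act R (G := G) H T p (.vert v) f w n = if w = v ∧ v ∉ H then f w n else 0 := by
  simp only [act, LinearMap.coe_mk, AddHom.coe_mk]
  congr

theorem act_ghost (H : Set G.V) (T p) (e : G.E) (f w n)
    [Decidable (w = G.rng e ∧ G.rng e ∉ H)] :
    act R (G := G) H T p (.ghost e) f w n =
      if w = G.rng e ∧ G.rng e ∉ H then f (G.src e) (p e n) else 0 := by
  simp only [act, LinearMap.coe_mk, AddHom.coe_mk]
  congr

theorem act_edge_none (H : Set G.V) (T p) (e : G.E) (f w m) (h : T w m = none) :
    act R (G := G) H T p (.edge e) f w m = 0 := by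
  simp [act, h]

theorem act_edge_some (H : Set G.V) (T p) (e e' : G.E) (f w m n) [Decidable (e' = e)]
    (h : T w m = some (e', n)) :
    act R (G := G) H T p (.edge e) f w m = if e' = e then f (G.rng e) n else 0 := by
  simp [act, h]

theorem exists_rep (H : Set G.V) (hH : G.Hereditary H) (hS : G.Saturated H) :
    ∃ Φ : Ambient R G →ₐ[R] Module.End R (G.V → ℕ → R),
      ∀ v, (v ∈ H → Φ (ugen R G (.vert v)) = 0) ∧
        (v ∉ H → Φ (ugen R G (.vert v)) (fun _ _ => 1) v 0 = 1) := by
  classical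
  obtain ⟨T, p, hT, hT'⟩ := exists_shift G H
  have hrel : ∀ ⦃x y⦄, LeavittRel R G x y →
      FreeAlgebra.lift R (act R H T p) x = FreeAlgebra.lift R (act R H T p) y := by
    intro x y hxy
    have hTe : ∀ e n, G.rng e ∉ H → T (G.src e) (p e n) = some (e, n) := fun e n h =>
      (hT _ _ _ _).2 ⟨h, rfl, rfl⟩
    cases hxy with
    | vert_mul_self v =>
      simp only [map_mul, FreeAlgebra.lift_ι_apply]
      ext f w n
      simp only [Module.End.mul_apply, act_vert]
      split_ifs <;> rfl
    | vert_mul_vert v v' h =>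
      simp only [map_mul, FreeAlgebra.lift_ι_apply, map_zero]
      ext f w n
      simp only [Module.End.mul_apply, act_vert]
      split_ifs with h1 h2
      · exact absurd (h1.1.symm.trans h2.1) h
      · rfl
      · rfl
    | src_mul_edge e =>
      simp only [map_mul, FreeAlgebra.lift_ι_apply]
      ext f w n
      simp only [Module.End.mul_apply, act_vert]
      rcases h : T w n with _ | ⟨e', m⟩
      · simp [act_edge_none R H T p e f w n h]
      · rw [act_edge_some R H T p e e' f w n m h]
        have h2 := (hT _ _ _ _).1 h
        by_cases he : e' = e
        · subst he
          rw [if_pos ⟨h2.2.1.symm, fun h3 => h2.1 (hH _ h3)⟩]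
        · simp [he]
    | edge_mul_rng e =>
      simp only [map_mul, FreeAlgebra.lift_ι_apply]
      ext f w n
      simp only [Module.End.mul_apply]
      rcases h : T w n with _ | ⟨e', m⟩
      · rw [act_edge_none R H T p e _ w n h, act_edge_none R H T p e _ w n h]
      · rw [act_edge_some R H T p e e' _ w n m h, act_edge_some R H T p e e' _ w n m h]
        have h2 := (hT _ _ _ _).1 h
        by_cases he : e' = e
        · subst he
          simp [act_vert, h2.1]
        · simp [he]
    | rng_mul_ghost e =>
      simp only [map_mul, FreeAlgebra.lift_ι_apply]
      ext f w n
      simp only [Module.End.mul_apply, act_vert, act_ghost]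
      split_ifs <;> rfl
    | ghost_mul_src e =>
      simp only [map_mul, FreeAlgebra.lift_ι_apply]
      ext f w n
      simp only [Module.End.mul_apply, act_vert, act_ghost]
      have := hH e
      split_ifs <;> first | rfl | tauto
    | ghost_mul_self e =>
      simp only [map_mul, FreeAlgebra.lift_ι_apply]
      ext f w n
      simp only [Module.End.mul_apply, act_vert, act_ghost]
      split_ifs with h
      · rw [act_edge_some R H T p e e _ _ _ n (hTe e n h.2), if_pos rfl, h.1]
      · rfl
    | ghost_mul_edge e e' h =>
      simp only [map_mul, FreeAlgebra.lift_ι_apply, map_zero]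
      ext f w n
      simp only [Module.End.mul_apply, act_ghost]
      split_ifs with h1
      · rw [act_edge_some R H T p e' e _ _ _ n (hTe e n h1.2), if_neg h]; rfl
      · rfl
    | ck v s hs hne =>
      simp only [map_mul, FreeAlgebra.lift_ι_apply, map_sum]
      ext f w n
      simp only [LinearMap.sum_apply, Finset.sum_apply, Module.End.mul_apply, act_vert]
      rcases h : T w n with _ | ⟨e', m⟩
      · rw [Finset.sum_eq_zero fun e _ => act_edge_none R H T p e _ w n h]
        rw [if_neg]
        rintro ⟨rfl, hv⟩
        refine hT' w n ?_ h
        by_contra hcon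
        push Not at hcon
        refine hv (hS w ⟨?_, ?_⟩ hcon)
        · exact s.finite_toSet.subset fun e he => (hs e).2 he
        · obtain ⟨e, he⟩ := hne
          exact ⟨e, (hs e).1 he⟩
      · have h2 := (hT _ _ _ _).1 h
        rw [Finset.sum_congr rfl fun e _ => act_edge_some R H T p e e' _ w n m h]
        rw [Finset.sum_ite_eq]
        simp only [hs, act_ghost]
        obtain ⟨h3, rfl, rfl⟩ := h2
        have := hH e'
        by_cases hv : G.src e' = v
        · subst hv
          simp only [true_and, if_true]
          rw [if_pos (fun h => h3 (this h)), if_pos h3]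
        · simp [hv]
  refine ⟨RingQuot.liftAlgHom R ⟨FreeAlgebra.lift R (act R H T p), hrel⟩, fun v => ?_⟩
  have : RingQuot.liftAlgHom R ⟨FreeAlgebra.lift R (act R H T p), hrel⟩ (ugen R G (.vert v)) =
      act R H T p (.vert v) := by
    simp [ugen]
  rw [this]
  constructor
  · intro hv
    ext f w n
    simp [act_vert, hv]
  · intro hv
    simp [act_vert, hv]

theorem sat_props (X : Set G.V) : G.Hereditary (G.saturation X) ∧
    G.Saturated (G.saturation X) ∧ X ⊆ G.saturation X := by
  refine ⟨?_, ?_, fun v hv => Set.mem_sInter.2 fun H hH => hH.2.2 hv⟩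
  · intro e he
    exact Set.mem_sInter.2 fun H hH => hH.1 e (Set.mem_sInter.1 he H hH)
  · intro v hreg he
    exact Set.mem_sInter.2 fun H hH => hH.2.1 v hreg
      fun e hes => Set.mem_sInter.1 (he e hes) H hH

theorem ideal_basic (X : Set G.V) : IsBasicIdeal R G (idealOfSet R G X) := by
  intro r v hr hv
  obtain ⟨h1, h2, h3⟩ := sat_props X
  obtain ⟨Φ, hΦ⟩ := exists_rep R _ h1 h2
  by_cases hvH : v ∈ G.saturation X
  · rw [ideal_sat]
    exact vert_mem_ideal R hvH
  exfalso
  let J : TwoSidedIdeal (LeavittPathAlgebra R G) :=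
    TwoSidedIdeal.mk' {x | Φ (x : Ambient R G) = 0}
      (by simp)
      (fun {x y} hx hy => by
        simp only [Set.mem_ofPred_eq] at hx hy ⊢
        rw [NonUnitalSubalgebra.coe_add, map_add, hx, hy, add_zero])
      (fun {x} hx => by
        simp only [Set.mem_ofPred_eq] at hx ⊢
        rw [NonUnitalSubalgebra.coe_neg, map_neg, hx, neg_zero])
      (fun {x y} hy => by
        simp only [Set.mem_ofPred_eq] at hy ⊢
        rw [NonUnitalSubalgebra.coe_mul, map_mul, hy, mul_zero])
      (fun {x y} hx => by
        simp only [Set.mem_ofPred_eq] at hx ⊢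
        rw [NonUnitalSubalgebra.coe_mul, map_mul, hx, zero_mul])
  have hJ : ∀ y, y ∈ J ↔ Φ (y : Ambient R G) = 0 := fun y =>
    TwoSidedIdeal.mem_mk' _ _ _ _ _ _ _
  have hle : idealOfSet R G X ≤ J := by
    refine TwoSidedIdeal.span_le.2 ?_
    rintro _ ⟨v, hv, rfl⟩
    exact (hJ _).2 ((hΦ v).1 (h3 hv))
  have := (hJ _).1 (hle hv)
  have e1 : ((r • vertexElem R G v : LeavittPathAlgebra R G) : Ambient R G) =
      r • ugen R G (.vert v) := rfl
  rw [e1, map_smul] at this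
  have e2 := congrFun (congrFun (LinearMap.congr_fun this (fun _ _ => 1)) v) 0
  simp only [LinearMap.smul_apply, Pi.smul_apply, (hΦ v).2 hvH] at e2
  exact hr (by simpa using e2)

end rels

end LPAGraph

open LPAGraph in
/-- **Lemma.**  If `X` is a hereditary subset of `E⁰` and `I_X` is the two-sided ideal of
`L_R(E)` generated by `{v : v ∈ X}`, then `I_X = I_{X̄}` where `X̄` is the saturation of `X`.
In particular `I_X` is a graded basic ideal that is also an idempotent ring. -/
theorem stmt13 (R : Type) [CommRing R] (G : LPAGraph)
    (X : Set G.V) (hX : G.Hereditary X) :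
    idealOfSet R G X = idealOfSet R G (G.saturation X) ∧
    IsGradedIdeal R G (idealOfSet R G X) ∧
    IsBasicIdeal R G (idealOfSet R G X) ∧
    (∀ x ∈ idealOfSet R G X, ∃ (n : ℕ) (a b : Fin n → LeavittPathAlgebra R G),
      (∀ i, a i ∈ idealOfSet R G X ∧ b i ∈ idealOfSet R G X) ∧ x = ∑ i, a i * b i) := by
  refine ⟨ideal_sat R X, ?_, ideal_basic R X, ?_⟩
  · intro x hx
    obtain ⟨n, a, b, h, rfl⟩ := ideal_decomp R hX x hx
    exact ⟨n, fun i => a i * b i,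
      fun i => ⟨TwoSidedIdeal.mul_mem_left _ _ _ (h i).2.1, (h i).2.2⟩, rfl⟩
  · intro x hx
    obtain ⟨n, a, b, h, rfl⟩ := ideal_decomp R hX x hx
    exact ⟨n, a, b, fun i => ⟨(h i).1, (h i).2.1⟩, rfl⟩
end
end
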